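/- arXiv:1611.04225 — 4 statements merged into one kernel-verified Lean document; each statement's English description precedes it below -/
import Mathlib

section
/- Let N be a binary phylogenetic network on X. Then l(N) = p(N) = t(N). -/
open Finset

/-- Raw data of a directed network on vertex type `V`: a finite edge set
    (so there are no parallel edges), a distinguished vertex subset `X`
    (the intended leaf set), and a root vertex. -/
structure Network (V : Type) where
  E : Finset (V × V)
  X : Finset V
  root : V

variable {V : Type} [Fintype V] [DecidableEq V]

/-- Adjacency relation of the digraph with edge set `E`. -/
def adjOf (E : Finset (V × V)) : V → V → Prop := fun a b => (a, b) ∈ E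

/-- In-degree of a vertex. -/
def inDeg (E : Finset (V × V)) (v : V) : ℕ := (E.filter fun e => e.2 = v).card

/-- Out-degree of a vertex. -/
def outDeg (E : Finset (V × V)) (v : V) : ℕ := (E.filter fun e => e.1 = v).card

/-- `N` is a (binary) phylogenetic network on `N.X`: a rooted acyclic digraph with
    no parallel edges in which the unique root has in-degree 0 and out-degree 2,
    the set of out-degree-0 vertices (the leaves) is exactly `X` (each such vertex
    having in-degree 1), and every other non-root vertex has in-degree 1 and
    out-degree 2, or in-degree 2 and out-degree 1; if `|X| = 1` the network may
    instead consist of a single vertex. -/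
def IsPhyloNetwork (N : Network V) : Prop :=
  N.X.Nonempty ∧
  (∀ v : V, ¬ Relation.TransGen (adjOf N.E) v v) ∧
  inDeg N.E N.root = 0 ∧
  (∀ v : V, Relation.ReflTransGen (adjOf N.E) N.root v) ∧
  N.X = Finset.univ.filter (fun v => outDeg N.E v = 0) ∧
  (Fintype.card V = 1 ∨
    (outDeg N.E N.root = 2 ∧
      ∀ v : V, v ≠ N.root →
        (inDeg N.E v = 1 ∧ outDeg N.E v = 0) ∨
        (inDeg N.E v = 1 ∧ outDeg N.E v = 2) ∨
        (inDeg N.E v = 2 ∧ outDeg N.E v = 1)))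

/-- A (nonempty) directed path in the digraph with edge set `E`, recorded as its
    list of vertices (consecutive vertices joined by an edge, no repeated vertex). -/
def IsDirPath (E : Finset (V × V)) (p : List V) : Prop :=
  p ≠ [] ∧ List.Chain' (adjOf E) p ∧ p.Nodup

/-- The path `p` ends at a vertex belonging to `S`. -/
def EndsIn (S : Finset V) (p : List V) : Prop := ∃ x ∈ S, p.getLast? = some x

/-- `(V, E')` is a rooted spanning tree with root `r`, all edges directed away
    from `r`: `r` has in-degree 0, every other vertex has in-degree 1, and every
    vertex is reachable from `r`. -/
def IsArborescence (E' : Finset (V × V)) (r : V) : Prop :=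
  inDeg E' r = 0 ∧ (∀ v : V, v ≠ r → inDeg E' v = 1) ∧
  ∀ v : V, Relation.ReflTransGen (adjOf E') r v

/-- `N` is tree-based: it has a rooted spanning tree `(V, E')` with `E' ⊆ E`
    all of whose leaves (out-degree-0 vertices) lie in `X`. -/
def TreeBased (N : Network V) : Prop :=
  ∃ (E' : Finset (V × V)) (r : V),
    E' ⊆ N.E ∧ IsArborescence E' r ∧ ∀ v : V, outDeg E' v = 0 → v ∈ N.X

/-- `S` is an antichain in the digraph with edge set `E`: for all distinct
    `u, v ∈ S` there is no directed path from `u` to `v`. -/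
def IsDigraphAntichain (E : Finset (V × V)) (S : Finset V) : Prop :=
  ∀ u ∈ S, ∀ v ∈ S, u ≠ v → ¬ Relation.ReflTransGen (adjOf E) u v

/-- The paths in `P` are pairwise vertex-disjoint. -/
def PairwiseDisjointPaths (P : Finset (List V)) : Prop :=
  ∀ p ∈ P, ∀ q ∈ P, p ≠ q → ∀ v : V, v ∈ p → v ∉ q

/-- Property (II): `N` has an antichain `A` and a partition of the vertex set into
    `|A|` blocks, each of which is the vertex set of a directed path in `N` ending
    at a leaf in `X`. -/
def AntichainPartition (N : Network V) : Prop :=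
  ∃ (A : Finset V) (P : Finset (List V)),
    IsDigraphAntichain N.E A ∧ P.card = A.card ∧
    (∀ p ∈ P, IsDirPath N.E p ∧ EndsIn N.X p) ∧
    ∀ v : V, ∃! p, p ∈ P ∧ v ∈ p

/-- There is a set of pairwise vertex-disjoint directed paths in `N`, each ending
    at a leaf in `X`, such that each element of `U` lies on exactly one path. -/
def CoversExactly (N : Network V) (U : Finset V) : Prop :=
  ∃ P : Finset (List V),
    (∀ p ∈ P, IsDirPath N.E p ∧ EndsIn N.X p) ∧
    PairwiseDisjointPaths P ∧
    ∀ u ∈ U, ∃! p, p ∈ P ∧ u ∈ p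

/-- Property (V): the vertex set of `N` can be partitioned into vertex sets of
    pairwise vertex-disjoint directed paths, each ending at a leaf in `X`. -/
def PathPartitionProp (N : Network V) : Prop :=
  ∃ P : Finset (List V),
    (∀ p ∈ P, IsDirPath N.E p ∧ EndsIn N.X p) ∧
    ∀ v : V, ∃! p, p ∈ P ∧ v ∈ p

/-- `p` is a directed path from `u` to `v`. -/
def PathFromTo (E : Finset (V × V)) (p : List V) (u v : V) : Prop :=
  IsDirPath E p ∧ p.head? = some u ∧ p.getLast? = some v

/-- The pair `(U₁, U₂)` witnesses the failure of property (IV): `|U₁| > |U₂|`,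
    (i) every directed path from a vertex of `U₁` to a vertex of `X` traverses a
    vertex of `U₂`, and (ii) for `{i,j} = {1,2}`, every directed path from a vertex
    of `Uᵢ` to another vertex of `Uᵢ` traverses a vertex of `Uⱼ`. -/
def BadPair (N : Network V) (U₁ U₂ : Finset V) : Prop :=
  U₂.card < U₁.card ∧
  (∀ (p : List V) (u x : V), u ∈ U₁ → x ∈ N.X → PathFromTo N.E p u x →
    ∃ w ∈ U₂, w ∈ p) ∧
  (∀ (p : List V) (u v : V), u ∈ U₁ → v ∈ U₁ → u ≠ v → PathFromTo N.E p u v →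
    ∃ w ∈ U₂, w ∈ p) ∧
  (∀ (p : List V) (u v : V), u ∈ U₂ → v ∈ U₂ → u ≠ v → PathFromTo N.E p u v →
    ∃ w ∈ U₁, w ∈ p)

/-- `M` is a matching of the bipartite graph `G_N` associated with the edge set `E`
    (vertex classes two disjoint copies `V₁, V₂` of `V`, with `u ∈ V₁` joined to
    `v ∈ V₂` exactly when `(u,v) ∈ E`): a set of edges of `G_N`, no two of which
    share an endpoint. -/
def IsMatching (E M : Finset (V × V)) : Prop :=
  M ⊆ E ∧ ∀ e ∈ M, ∀ f ∈ M, e ≠ f → e.1 ≠ f.1 ∧ e.2 ≠ f.2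

/-- `N` is temporal: there is `λ : V → ℝ` with `λ u = λ v` for every reticulation
    edge `(u,v)` (an edge into an in-degree-2 vertex) and `λ u < λ v` for every
    other (tree) edge `(u,v)`. -/
def IsTemporal (N : Network V) : Prop :=
  ∃ lam : V → ℝ, ∀ e ∈ N.E,
    (inDeg N.E e.2 = 2 → lam e.1 = lam e.2) ∧
    (inDeg N.E e.2 ≠ 2 → lam e.1 < lam e.2)

/-- `N` satisfies the antichain-to-leaf property: for every antichain `S` of `N`
    there exist `|S|` pairwise vertex-disjoint directed paths from the elements of
    `S` to leaves of `N`. -/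
def AntichainToLeaf (N : Network V) : Prop :=
  ∀ S : Finset V, IsDigraphAntichain N.E S →
    ∃ P : Finset (List V), P.card = S.card ∧
      (∀ p ∈ P, IsDirPath N.E p ∧ EndsIn N.X p) ∧
      PairwiseDisjointPaths P ∧
      ∀ s ∈ S, ∃ p ∈ P, p.head? = some s

/-- `(V, E)` with root `r` is (up to the intrinsic degree characterisation) a
    subdivision of a rooted binary tree: a rooted tree, all edges directed away
    from the root, with every out-degree at most 2 and (unless it is a single
    vertex) root of out-degree exactly 2 — precisely the graphs obtained from a
    rooted binary tree by repeatedly subdividing edges. -/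
def IsSubdividedRootedBinaryTree (E : Finset (V × V)) (r : V) : Prop :=
  IsArborescence E r ∧ (∀ v : V, outDeg E v ≤ 2) ∧
  (Fintype.card V = 1 ∨ outDeg E r = 2)

/-- `d(N)`: the smallest number of pairwise vertex-disjoint directed paths whose
    vertex sets partition the vertex set of `N`. -/
noncomputable def dN (N : Network V) : ℕ :=
  sInf {k | ∃ P : Finset (List V), P.card = k ∧ (∀ p ∈ P, IsDirPath N.E p) ∧
    ∀ v : V, ∃! p, p ∈ P ∧ v ∈ p}

/-- `p(N) = d(N) - |X|`. -/
noncomputable def pN (N : Network V) : ℕ := dN N - N.X.card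

/-- The size of a maximum-sized matching of the bipartite graph `G_N`. -/
noncomputable def maxMatchingCard (E : Finset (V × V)) : ℕ :=
  sSup {k | ∃ M : Finset (V × V), IsMatching E M ∧ M.card = k}

/-- `u(G_N)`: the number of vertices of the copy `V₁` of `V` left unmatched by a
    maximum-sized matching of `G_N`. -/
noncomputable def uGN (N : Network V) : ℕ := Fintype.card V - maxMatchingCard N.E

/-- `l(N)`: the minimum, over all rooted spanning trees of `N`, of the number of
    leaves of the spanning tree lying outside `X`. -/
noncomputable def lN (N : Network V) : ℕ :=
  sInf {k | ∃ (E' : Finset (V × V)) (r : V), E' ⊆ N.E ∧ IsArborescence E' r ∧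
    (Finset.univ.filter fun v => outDeg E' v = 0 ∧ v ∉ N.X).card = k}

/-- The network obtained from `N` by attaching a new leaf to the edge `e`:
    `e` is subdivided by the new vertex `Sum.inr 0`, and the new leaf `Sum.inr 1`
    is made a child of `Sum.inr 0` and added to `X`. -/
def attachLeaf (N : Network V) (e : V × V) : Network (V ⊕ Fin 2) where
  E := ((N.E.erase e).image fun f => (Sum.inl f.1, Sum.inl f.2)) ∪
    {(Sum.inl e.1, Sum.inr 0), (Sum.inr 0, Sum.inl e.2), (Sum.inr 0, Sum.inr 1)}
  X := N.X.image Sum.inl ∪ {Sum.inr 1}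
  root := Sum.inl N.root

/-- `CanMakeTreeBased k N`: one can attach `k` new leaves to `N`, one after the
    other (each to an edge of the current network), so that the resulting network
    is tree-based. -/
def CanMakeTreeBased : ℕ → {V : Type} → [Fintype V] → [DecidableEq V] →
    Network V → Prop
  | 0, _, _, _, N => TreeBased N
  | k + 1, _, _, _, N => ∃ e ∈ N.E, CanMakeTreeBased k (attachLeaf N e)

/-- `t(N)`: the minimum number of leaves that must be attached to `N` so that the
    resulting network is tree-based. -/
noncomputable def tN (N : Network V) : ℕ := sInf {k | CanMakeTreeBased k N}

/-- The network obtained from `N` by simultaneously attaching one new leaf to each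
    edge in `F`: each `f ∈ F` is subdivided by the new vertex `Sum.inr (f, 0)`,
    which also gets the new leaf `Sum.inr (f, 1)` as a child. -/
def attachAll (N : Network V) (F : Finset (V × V)) :
    Network (V ⊕ ((V × V) × Fin 2)) where
  E := ((N.E \ F).image fun f => (Sum.inl f.1, Sum.inl f.2)) ∪
    (F.image fun f => (Sum.inl f.1, Sum.inr (f, 0))) ∪
    (F.image fun f => (Sum.inr (f, 0), Sum.inl f.2)) ∪
    (F.image fun f => (Sum.inr (f, 0), Sum.inr (f, 1)))
  X := N.X.image Sum.inl ∪ F.image fun f => Sum.inr (f, 1)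
  root := Sum.inl N.root

section Aux

theorem outDeg_zero_iff {V : Type} [Fintype V] [DecidableEq V] (E : Finset (V × V)) (v : V) :
    outDeg E v = 0 ↔ ∀ w, (v, w) ∉ E := by
  unfold outDeg
  rw [Finset.card_eq_zero, Finset.filter_eq_empty_iff]
  constructor
  · intro h w hw
    exact h hw rfl
  · rintro h ⟨a, b⟩ hab rfl
    exact h b hab

theorem inDeg_zero_iff {V : Type} [Fintype V] [DecidableEq V] (E : Finset (V × V)) (v : V) :
    inDeg E v = 0 ↔ ∀ u, (u, v) ∉ E := by
  unfold inDeg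
  rw [Finset.card_eq_zero, Finset.filter_eq_empty_iff]
  constructor
  · intro h w hw
    exact h hw rfl
  · rintro h ⟨a, b⟩ hab rfl
    exact h a hab

theorem inDeg_one_iff {V : Type} [Fintype V] [DecidableEq V] (E : Finset (V × V)) (v : V) :
    inDeg E v = 1 ↔ ∃ u, (u, v) ∈ E ∧ ∀ w, (w, v) ∈ E → w = u := by
  unfold inDeg
  rw [Finset.card_eq_one]
  constructor
  · rintro ⟨⟨a, b⟩, h⟩
    have h1 : (a, b) ∈ E.filter (fun e => e.2 = v) := by rw [h]; simp
    rw [Finset.mem_filter] at h1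
    obtain ⟨h1, h2⟩ := h1
    simp only at h2
    subst h2
    refine ⟨a, h1, fun w hw => ?_⟩
    have h3 : (w, b) ∈ E.filter (fun e => e.2 = b) := by simp [hw]
    rw [h] at h3
    simpa using h3
  · rintro ⟨u, hu, h⟩
    refine ⟨(u, v), ?_⟩
    ext ⟨a, b⟩
    simp only [Finset.mem_filter, Finset.mem_singleton, Prod.mk.injEq]
    constructor
    · rintro ⟨h1, rfl⟩
      exact ⟨h _ h1, rfl⟩
    · rintro ⟨rfl, rfl⟩
      exact ⟨hu, rfl⟩

theorem matching_card {V : Type} [Fintype V] [DecidableEq V] {E M : Finset (V × V)}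
    (hM : IsMatching E M) :
    M.card + (Finset.univ.filter fun v => outDeg M v = 0).card = Fintype.card V := by
  have h1 : (M.image Prod.fst).card = M.card := by
    apply Finset.card_image_of_injOn
    intro e he f hf hef
    by_contra hne
    exact (hM.2 e he f hf hne).1 hef
  have h2 : (Finset.univ.filter fun v => outDeg M v = 0) = (M.image Prod.fst)ᶜ := by
    ext v
    simp [outDeg_zero_iff]
  rw [h2, ← h1, Finset.card_add_card_compl]

/-- Arborescence to matching. -/
theorem arb_to_matching {V : Type} [Fintype V] [DecidableEq V] {E E' : Finset (V × V)} {r : V}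
    (hsub : E' ⊆ E) (ha : IsArborescence E' r) :
    ∃ M, IsMatching E M ∧
      Fintype.card V = M.card + (Finset.univ.filter fun v => outDeg E' v = 0).card := by
  classical
  have hex : ∀ v : V, ∃ w, outDeg E' v ≠ 0 → (v, w) ∈ E' := by
    intro v
    by_cases h : outDeg E' v = 0
    · exact ⟨v, fun h' => absurd h h'⟩
    · have h' := h
      rw [outDeg_zero_iff] at h'
      push Not at h'
      obtain ⟨w, hw⟩ := h'
      exact ⟨w, fun _ => hw⟩
  choose s hs using hex
  set T := Finset.univ.filter fun v => outDeg E' v ≠ 0 with hT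
  refine ⟨T.image fun v => (v, s v), ⟨?_, ?_⟩, ?_⟩
  · intro e he
    obtain ⟨v, hv, rfl⟩ := Finset.mem_image.1 he
    exact hsub (hs v (by simpa [hT] using hv))
  · intro e he f hf hne
    obtain ⟨v, hv, rfl⟩ := Finset.mem_image.1 he
    obtain ⟨w, hw, rfl⟩ := Finset.mem_image.1 hf
    have hv' := hs v (by simpa [hT] using hv)
    have hw' := hs w (by simpa [hT] using hw)
    have hvw : v ≠ w := by
      rintro rfl
      exact hne rfl
    refine ⟨hvw, fun heq => ?_⟩
    simp only at heq
    rw [← heq] at hw'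
    by_cases hr : s v = r
    · rw [hr] at hv'
      exact (inDeg_zero_iff E' r).1 ha.1 v hv'
    · obtain ⟨u, _, hu⟩ := (inDeg_one_iff E' _).1 (ha.2.1 _ hr)
      exact hvw ((hu v hv').trans (hu w hw').symm)
  · rw [Finset.card_image_of_injective _ (fun a b h => (Prod.mk.inj h).1)]
    have := Finset.card_filter_add_card_filter_not (s := (Finset.univ : Finset V))
      (fun v => outDeg E' v = 0)
    rw [Finset.card_univ] at this
    rw [hT]
    simp only [ne_eq]
    omega

/-- Matching to arborescence. -/
theorem matching_to_arb {V : Type} [Fintype V] [DecidableEq V] {E M : Finset (V × V)} {r : V}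
    (hac : ∀ v : V, ¬ Relation.TransGen (adjOf E) v v)
    (hr : inDeg E r = 0) (hreach : ∀ v : V, Relation.ReflTransGen (adjOf E) r v)
    (hM : IsMatching E M) :
    ∃ E', E' ⊆ E ∧ IsArborescence E' r ∧ M ⊆ E' := by
  classical
  have hex : ∀ v : V, ∃ u, v ≠ r → (u, v) ∈ E ∧ ∀ w, (w, v) ∈ M → w = u := by
    intro v
    by_cases hv : v = r
    · exact ⟨v, fun h => absurd hv h⟩
    by_cases hm : ∃ u, (u, v) ∈ M
    · obtain ⟨u, hu⟩ := hm
      refine ⟨u, fun _ => ⟨hM.1 hu, fun w hw => ?_⟩⟩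
      by_contra hne
      exact (hM.2 _ hw _ hu (fun h => hne (Prod.mk.inj h).1)).2 rfl
    · rcases Relation.ReflTransGen.cases_tail (hreach v) with h | ⟨u, _, hu⟩
      · exact absurd h hv
      · exact ⟨u, fun _ => ⟨hu, fun w hw => absurd ⟨w, hw⟩ hm⟩⟩
  choose s hs using hex
  have hmem : ∀ a b, (a, b) ∈ (Finset.univ.erase r).image (fun v => (s v, v)) ↔
      b ≠ r ∧ a = s b := by
    intro a b
    simp only [Finset.mem_image, Finset.mem_erase, Finset.mem_univ, and_true, Prod.mk.injEq]
    constructor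
    · rintro ⟨v, hv, h1, rfl⟩
      exact ⟨hv, h1.symm⟩
    · rintro ⟨h1, rfl⟩
      exact ⟨b, h1, rfl, rfl⟩
  refine ⟨(Finset.univ.erase r).image (fun v => (s v, v)), ?_, ⟨?_, ?_, ?_⟩, ?_⟩
  · rintro ⟨a, b⟩ h
    obtain ⟨h1, rfl⟩ := (hmem a b).1 h
    exact (hs b h1).1
  · rw [inDeg_zero_iff]
    intro u hu
    exact ((hmem u r).1 hu).1 rfl
  · intro v hv
    rw [inDeg_one_iff]
    exact ⟨s v, (hmem _ _).2 ⟨hv, rfl⟩, fun w hw => ((hmem _ _).1 hw).2⟩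
  · have : IsTrans V (Relation.TransGen (adjOf E)) := ⟨fun _ _ _ h1 h2 => h1.trans h2⟩
    have : Std.Irrefl (Relation.TransGen (adjOf E)) := ⟨hac⟩
    have wf := Finite.wellFounded_of_trans_of_irrefl (Relation.TransGen (adjOf E))
    intro v
    induction v using wf.induction with
    | _ v ih =>
      by_cases hv : v = r
      · rw [hv]
      · exact (ih (s v) (Relation.TransGen.single (hs v hv).1)).tail
          ((hmem _ _).2 ⟨hv, rfl⟩)
  · rintro ⟨a, b⟩ h
    have hb : b ≠ r := by
      rintro rfl
      exact (inDeg_zero_iff E b).1 hr a (hM.1 h)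
    exact (hmem _ _).2 ⟨hb, (hs b hb).2 a h⟩

/-- Path partition to matching. -/
theorem paths_to_matching {V : Type} [Fintype V] [DecidableEq V] {E : Finset (V × V)}
    {P : Finset (List V)} (hP : ∀ p ∈ P, IsDirPath E p)
    (hpart : ∀ v : V, ∃! p, p ∈ P ∧ v ∈ p) :
    ∃ M, IsMatching E M ∧ Fintype.card V ≤ M.card + P.card := by
  classical
  set M : Finset (V × V) := Finset.univ.filter fun e =>
    ∃ p ∈ P, ∃ s t, p = s ++ e.1 :: e.2 :: t with hMdef
  have hM : IsMatching E M := by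
    constructor
    · rintro ⟨a, b⟩ h
      obtain ⟨p, hp, s, t, rfl⟩ := (Finset.mem_filter.1 h).2
      exact (List.isChain_append_cons_cons.1 (hP _ hp).2.1).2.1
    · rintro ⟨a, b⟩ he ⟨a', b'⟩ hf hne
      obtain ⟨p, hp, s, t, hpe⟩ := (Finset.mem_filter.1 he).2
      obtain ⟨q, hq, s', t', hqe⟩ := (Finset.mem_filter.1 hf).2
      simp only at hpe hqe
      constructor
      · rintro h
        simp only at h
        subst h
        have hpq : p = q := (hpart a).unique ⟨hp, by simp [hpe]⟩ ⟨hq, by simp [hqe]⟩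
        subst hpq
        have hnd := (hP p hp).2.2
        have hnd' := hnd
        rw [hpe] at hnd
        rw [hqe] at hnd'
        have heq := hpe.symm.trans hqe
        rw [List.append_cons_inj_of_notMem] at heq
        · obtain ⟨-, -, h3⟩ := heq
          exact hne (by rw [(List.cons.inj h3).1])
        all_goals
          simp only [List.nodup_append, List.nodup_cons] at hnd hnd'
          grind
      · rintro h
        simp only at h
        subst h
        have hpq : p = q := (hpart b).unique ⟨hp, by simp [hpe]⟩ ⟨hq, by simp [hqe]⟩
        subst hpq
        have hnd := (hP p hp).2.2
        have hnd' := hnd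
        rw [hpe] at hnd
        rw [hqe] at hnd'
        have heq : (s ++ [a]) ++ b :: t = (s' ++ [a']) ++ b :: t' := by
          simpa using hpe.symm.trans hqe
        rw [List.append_cons_inj_of_notMem] at heq
        · obtain ⟨h3, -, -⟩ := heq
          have h4 := (List.append_inj' h3 rfl).2
          exact hne (by rw [(List.cons.inj h4).1])
        all_goals
          simp only [List.nodup_append, List.nodup_cons] at hnd hnd'
          grind
  refine ⟨M, hM, ?_⟩
  rw [← matching_card hM]
  apply Nat.add_le_add_left
  have hsub : (Finset.univ.filter fun v => outDeg M v = 0).image some ⊆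
      P.image List.getLast? := by
    intro x hx
    obtain ⟨v, hv, rfl⟩ := Finset.mem_image.1 hx
    have hv' := (outDeg_zero_iff M v).1 (Finset.mem_filter.1 hv).2
    obtain ⟨p, ⟨hp, hvp⟩, -⟩ := hpart v
    refine Finset.mem_image.2 ⟨p, hp, ?_⟩
    obtain ⟨s, t, rfl⟩ := List.append_of_mem hvp
    cases t with
    | nil => simp
    | cons b t =>
      exact absurd (Finset.mem_filter.2 ⟨Finset.mem_univ _, _, hp, s, t, rfl⟩) (hv' b)
  calc _ = ((Finset.univ.filter fun v => outDeg M v = 0).image some).card :=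
        (Finset.card_image_of_injective _ (Option.some_injective V)).symm
    _ ≤ _ := Finset.card_le_card hsub
    _ ≤ _ := Finset.card_image_le

theorem IsMatching.mono {V : Type} [Fintype V] [DecidableEq V] {E M M' : Finset (V × V)}
    (hM : IsMatching E M) (h : M' ⊆ M) : IsMatching E M' :=
  ⟨h.trans hM.1, fun e he f hf => hM.2 e (h he) f (h hf)⟩

/-- Matching to path partition. -/
theorem matching_to_paths {V : Type} [Fintype V] [DecidableEq V] {E : Finset (V × V)}
    (hac : ∀ v : V, ¬ Relation.TransGen (adjOf E) v v) (M : Finset (V × V)) :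
    IsMatching E M →
    ∃ P : Finset (List V), P.card + M.card = Fintype.card V ∧ (∀ p ∈ P, IsDirPath M p) ∧
      ∀ v : V, ∃! p, p ∈ P ∧ v ∈ p := by
  classical
  induction M using Finset.induction_on with
  | empty =>
    intro _
    refine ⟨Finset.univ.image fun v => [v], ?_, ?_, ?_⟩
    · rw [Finset.card_image_of_injective _ (fun a b h => (List.cons.inj h).1)]
      simp
    · intro p hp
      obtain ⟨v, -, rfl⟩ := Finset.mem_image.1 hp
      exact ⟨by simp, List.isChain_singleton _, by simp⟩
    · intro v
      refine ⟨[v], by simp, ?_⟩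
      rintro p ⟨hp, hv⟩
      obtain ⟨w, -, rfl⟩ := Finset.mem_image.1 hp
      simp at hv
      rw [hv]
  | insert e M heM ih =>
    intro hM
    obtain ⟨a, b⟩ := e
    obtain ⟨P, hcard, hP, hpart⟩ := ih (hM.mono (Finset.subset_insert _ _))
    obtain ⟨p, ⟨hp, hap⟩, hpu⟩ := hpart a
    obtain ⟨q, ⟨hq, hbq⟩, hqu⟩ := hpart b
    have hM1 : ∀ c, (a, c) ∉ M := by
      intro c hc
      exact (hM.2 (a, b) (by simp) (a, c) (by simp [hc]) (by rintro h; rw [h] at heM; exact heM hc)).1 rfl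
    have hM2 : ∀ c, (c, b) ∉ M := by
      intro c hc
      exact (hM.2 (a, b) (by simp) (c, b) (by simp [hc]) (by rintro h; rw [h] at heM; exact heM hc)).2 rfl
    have hpa : ∃ s, p = s ++ [a] := by
      obtain ⟨s, t, rfl⟩ := List.append_of_mem hap
      cases t with
      | nil => exact ⟨s, rfl⟩
      | cons c t =>
        exact absurd (List.isChain_append_cons_cons.1 (hP _ hp).2.1).2.1 (hM1 c)
    have hqb : ∃ t, q = b :: t := by
      obtain ⟨s, t, rfl⟩ := List.append_of_mem hbq
      rcases List.eq_nil_or_concat s with rfl | ⟨s', c, rfl⟩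
      · exact ⟨t, rfl⟩
      · have h := (hP _ hq).2.1
        rw [List.concat_eq_append, List.append_assoc, List.singleton_append] at h
        exact absurd (List.isChain_append_cons_cons.1 h).2.1 (hM2 c)
    obtain ⟨s, hs⟩ := hpa
    obtain ⟨t, ht⟩ := hqb
    have hMle : ∀ x y, adjOf M x y → adjOf (insert (a, b) M) x y := by
      intro x y h
      exact Finset.mem_insert_of_mem h
    have hpq : p ≠ q := by
      intro h
      have hne : q ≠ [] := by simp [ht]
      have h1 := List.relationReflTransGen_of_exists_isChain q (hP _ hq).2.1 hne
      have hh : q.head hne = b := by simp [ht]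
      have hl : q.getLast hne = a := by simp [← h, hs]
      rw [hh, hl] at h1
      have h2 : Relation.ReflTransGen (adjOf E) b a :=
        Relation.ReflTransGen.mono (fun x y hxy => hM.1 (hMle x y hxy)) _ _ h1
      exact hac b (Relation.TransGen.tail' h2 (hM.1 (by simp : (a, b) ∈ insert (a, b) M)))
    have hdisj : ∀ v, v ∈ p → v ∈ q → False := fun v h1 h2 =>
      hpq ((hpart v).unique ⟨hp, h1⟩ ⟨hq, h2⟩)
    have hnew : p ++ q ∉ P := by
      intro h
      have h1 : p ++ q = p := hpu _ ⟨h, by simp [hap]⟩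
      simp [ht] at h1
    refine ⟨insert (p ++ q) ((P.erase p).erase q), ?_, ?_, ?_⟩
    · rw [Finset.card_insert_of_notMem (by simp only [Finset.mem_erase]; tauto),
        Finset.card_erase_of_mem (Finset.mem_erase.2 ⟨hpq.symm, hq⟩),
        Finset.card_erase_of_mem hp, Finset.card_insert_of_notMem heM]
      have : 1 < P.card := Finset.one_lt_card.2 ⟨p, hp, q, hq, hpq⟩
      omega
    · intro x hx
      rcases Finset.mem_insert.1 hx with rfl | hx
      · refine ⟨by simp [ht], ?_, ?_⟩
        · refine List.IsChain.append ((hP _ hp).2.1.imp hMle) ((hP _ hq).2.1.imp hMle) ?_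
          intro x hx y hy
          simp [hs] at hx
          simp [ht] at hy
          subst hx hy
          simp [adjOf]
        · exact List.Nodup.append (hP _ hp).2.2 (hP _ hq).2.2 (fun v h1 h2 => hdisj v h1 h2)
      · have hx' := hP x (Finset.mem_of_mem_erase (Finset.mem_of_mem_erase hx))
        exact ⟨hx'.1, hx'.2.1.imp hMle, hx'.2.2⟩
    · intro v
      by_cases hv : v ∈ p ++ q
      · refine ⟨p ++ q, ⟨by simp, hv⟩, ?_⟩
        rintro y ⟨hy, hvy⟩
        rcases Finset.mem_insert.1 hy with rfl | hy
        · rfl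
        · simp only [Finset.mem_erase] at hy
          obtain ⟨h1, h2, h3⟩ := hy
          rcases List.mem_append.1 hv with h | h
          · exact absurd ((hpart v).unique ⟨h3, hvy⟩ ⟨hp, h⟩) h2
          · exact absurd ((hpart v).unique ⟨h3, hvy⟩ ⟨hq, h⟩) h1
      · obtain ⟨x, ⟨hx, hvx⟩, hxu⟩ := hpart v
        rw [List.mem_append, not_or] at hv
        refine ⟨x, ⟨?_, hvx⟩, ?_⟩
        · refine Finset.mem_insert_of_mem ?_
          simp only [Finset.mem_erase]
          refine ⟨?_, ?_, hx⟩
          · rintro rfl; exact hv.2 hvx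
          · rintro rfl; exact hv.1 hvx
        · rintro y ⟨hy, hvy⟩
          rcases Finset.mem_insert.1 hy with rfl | hy
          · rcases List.mem_append.1 hvy with h | h
            · exact absurd h hv.1
            · exact absurd h hv.2
          · exact hxu y ⟨Finset.mem_of_mem_erase (Finset.mem_of_mem_erase hy), hvy⟩

/-- An arborescence with `k` bad leaves gives a way of attaching `k` leaves. -/
theorem arb_to_attach (k : ℕ) : ∀ {V : Type} [Fintype V] [DecidableEq V] (N : Network V)
    (_ : ∀ v, v ∉ N.X → ∃ w, (v, w) ∈ N.E) (E' : Finset (V × V)) (r : V),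
    E' ⊆ N.E → IsArborescence E' r →
    (Finset.univ.filter fun v => outDeg E' v = 0 ∧ v ∉ N.X).card = k →
    CanMakeTreeBased k N := by
  induction k with
  | zero =>
    intro V _ _ N _ E' r hsub ha hk
    refine ⟨E', r, hsub, ha, fun v hv => ?_⟩
    by_contra hx
    rw [Finset.card_eq_zero, Finset.filter_eq_empty_iff] at hk
    exact hk (Finset.mem_univ v) ⟨hv, hx⟩
  | succ k ih =>
    intro V _ _ N hN E' r hsub ha hk
    obtain ⟨a, haS⟩ : (Finset.univ.filter fun v => outDeg E' v = 0 ∧ v ∉ N.X).Nonempty := by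
      rw [← Finset.card_pos]; omega
    obtain ⟨ha0, haX⟩ := (Finset.mem_filter.1 haS).2
    rw [outDeg_zero_iff] at ha0
    obtain ⟨b, hab⟩ := hN a haX
    refine ⟨(a, b), hab, ?_⟩
    set E'' : Finset ((V ⊕ Fin 2) × (V ⊕ Fin 2)) :=
      (E'.image fun f => (Sum.inl f.1, Sum.inl f.2)) ∪
        {(Sum.inl a, Sum.inr 0), (Sum.inr 0, Sum.inr 1)} with hE''
    have m1 : ∀ x y : V, ((Sum.inl x, Sum.inl y) : (V ⊕ Fin 2) × (V ⊕ Fin 2)) ∈ E'' ↔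
        (x, y) ∈ E' := by
      intro x y; simp [hE'']
    have m2 : ∀ (x : V) (i : Fin 2), ((Sum.inl x, Sum.inr i) : (V ⊕ Fin 2) × (V ⊕ Fin 2)) ∈ E'' ↔
        x = a ∧ i = 0 := by
      intro x y; simp [hE'']
    have m3 : ∀ (x : V) (i : Fin 2), ((Sum.inr i, Sum.inl x) : (V ⊕ Fin 2) × (V ⊕ Fin 2)) ∉ E'' := by
      intro x y; simp [hE'']
    have m4 : ∀ (i j : Fin 2), ((Sum.inr i, Sum.inr j) : (V ⊕ Fin 2) × (V ⊕ Fin 2)) ∈ E'' ↔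
        i = 0 ∧ j = 1 := by
      intro x y; simp [hE'']
    refine ih (attachLeaf N (a, b)) ?_ E'' (Sum.inl r) ?_ ⟨?_, ?_, ?_⟩ ?_
    · rintro (v | i) hv
      · obtain ⟨w, hw⟩ := hN v (by simpa [attachLeaf] using hv)
        by_cases h : (v, w) = (a, b)
        · obtain ⟨rfl, rfl⟩ := Prod.mk.inj h
          exact ⟨Sum.inr 0, by simp [attachLeaf]⟩
        · refine ⟨Sum.inl w, ?_⟩
          simp only [attachLeaf, Finset.mem_union, Finset.mem_image, Finset.mem_erase]
          exact Or.inl ⟨(v, w), ⟨h, hw⟩, rfl⟩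
      · fin_cases i
        · exact ⟨Sum.inr 1, by simp [attachLeaf]⟩
        · simp [attachLeaf] at hv
    · intro e he
      rcases Finset.mem_union.1 he with he | he
      · obtain ⟨f, hf, rfl⟩ := Finset.mem_image.1 he
        simp only [attachLeaf, Finset.mem_union, Finset.mem_image, Finset.mem_erase]
        refine Or.inl ⟨f, ⟨?_, hsub hf⟩, rfl⟩
        rintro rfl
        exact ha0 b hf
      · simp only [Finset.mem_insert, Finset.mem_singleton] at he
        rcases he with rfl | rfl <;> simp [attachLeaf]
    · rw [inDeg_zero_iff]
      rintro (u | i)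
      · rw [m1]
        exact (inDeg_zero_iff _ _).1 ha.1 u
      · exact m3 _ _
    · rintro (v | i) hv
      · obtain ⟨u, hu, huu⟩ := (inDeg_one_iff _ _).1 (ha.2.1 v (fun h => hv (by rw [h])))
        rw [inDeg_one_iff]
        refine ⟨Sum.inl u, (m1 _ _).2 hu, ?_⟩
        rintro (w | j) hw
        · rw [huu w ((m1 _ _).1 hw)]
        · exact absurd hw (m3 _ _)
      · rw [inDeg_one_iff]
        fin_cases i
        · refine ⟨Sum.inl a, (m2 _ _).2 ⟨rfl, rfl⟩, ?_⟩
          rintro (w | j) hw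
          · rw [((m2 _ _).1 hw).1]
          · exact absurd ((m4 _ _).1 hw).2 (by decide)
        · refine ⟨Sum.inr 0, (m4 _ _).2 ⟨rfl, rfl⟩, ?_⟩
          rintro (w | j) hw
          · exact absurd ((m2 _ _).1 hw).2 (by decide)
          · rw [((m4 _ _).1 hw).1]
    · have hl : ∀ v : V, Relation.ReflTransGen (adjOf E'') (Sum.inl r) (Sum.inl v) := fun v =>
        Relation.ReflTransGen.lift (r := adjOf E') (p := adjOf E'') Sum.inl
          (fun x y h => (m1 x y).2 h) _ _ (ha.2.2 v)
      have h0 : Relation.ReflTransGen (adjOf E'') (Sum.inl r) (Sum.inr 0) :=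
        (hl a).tail ((m2 _ _).2 ⟨rfl, rfl⟩)
      rintro (v | i)
      · exact hl v
      · fin_cases i
        · exact h0
        · exact h0.tail ((m4 _ _).2 ⟨rfl, rfl⟩)
    · have : (Finset.univ.filter fun v => outDeg E'' v = 0 ∧ v ∉ (attachLeaf N (a, b)).X) =
          ((Finset.univ.filter fun v => outDeg E' v = 0 ∧ v ∉ N.X).erase a).image Sum.inl := by
        ext x
        rcases x with v | i
        · simp only [Finset.mem_filter, Finset.mem_univ, true_and, Finset.mem_image,
            Finset.mem_erase, Sum.inl.injEq, exists_eq_right]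
          rw [outDeg_zero_iff, outDeg_zero_iff]
          have hX : Sum.inl v ∉ (attachLeaf N (a, b)).X ↔ v ∉ N.X := by simp [attachLeaf]
          rw [hX]
          constructor
          · rintro ⟨h1, h2⟩
            refine ⟨?_, fun w hw => h1 (Sum.inl w) ((m1 _ _).2 hw), h2⟩
            rintro rfl
            exact h1 (Sum.inr 0) ((m2 _ _).2 ⟨rfl, rfl⟩)
          · rintro ⟨h0, h1, h2⟩
            refine ⟨?_, h2⟩
            rintro (w | j) hw
            · exact h1 w ((m1 _ _).1 hw)
            · exact h0 ((m2 _ _).1 hw).1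
        · simp only [Finset.mem_filter, Finset.mem_univ, true_and, Finset.mem_image,
            reduceCtorEq, and_false, exists_false, iff_false]
          rw [outDeg_zero_iff]
          rintro ⟨h1, h2⟩
          fin_cases i
          · exact h1 (Sum.inr 1) ((m4 _ _).2 ⟨rfl, rfl⟩)
          · simp [attachLeaf] at h2
      rw [this, Finset.card_image_of_injective _ Sum.inl_injective, Finset.card_erase_of_mem haS,
        hk]
      rfl

/-- If attaching `k` leaves makes `N` tree-based, there is a large matching. -/
theorem attach_to_matching (k : ℕ) : ∀ {V : Type} [Fintype V] [DecidableEq V] (N : Network V),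
    CanMakeTreeBased k N →
    ∃ M, IsMatching N.E M ∧ Fintype.card V ≤ M.card + N.X.card + k := by
  induction k with
  | zero =>
    intro V _ _ N h
    obtain ⟨E', r, hsub, ha, hl⟩ := h
    obtain ⟨M, hM, hc⟩ := arb_to_matching hsub ha
    refine ⟨M, hM, ?_⟩
    have : (Finset.univ.filter fun v => outDeg E' v = 0).card ≤ N.X.card :=
      Finset.card_le_card (fun v hv => hl v (Finset.mem_filter.1 hv).2)
    omega
  | succ k ih =>
    intro V _ _ N h
    obtain ⟨e, he, h⟩ := h
    obtain ⟨M', hM', hc⟩ := ih _ h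
    set M : Finset (V × V) := Finset.univ.filter fun f =>
      ((Sum.inl f.1, Sum.inl f.2) : (V ⊕ Fin 2) × (V ⊕ Fin 2)) ∈ M' with hMd
    have hM : IsMatching N.E M := by
      constructor
      · intro f hf
        have h1 := hM'.1 (Finset.mem_filter.1 hf).2
        simp [attachLeaf] at h1
        exact h1.2
      · intro f hf g hg hne
        have := hM'.2 _ (Finset.mem_filter.1 hf).2 _ (Finset.mem_filter.1 hg).2
          (fun h => hne (by
            obtain ⟨h1, h2⟩ := Prod.mk.inj h
            exact Prod.ext (Sum.inl_injective h1) (Sum.inl_injective h2)))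
        exact ⟨fun h => this.1 (by simp [h]), fun h => this.2 (by simp [h])⟩
    refine ⟨M, hM, ?_⟩
    have hA : (M'.filter fun f => f.1 = Sum.inr 0).card ≤ 1 := by
      rw [Finset.card_le_one]
      intro f hf g hg
      rw [Finset.mem_filter] at hf hg
      by_contra hne
      exact (hM'.2 f hf.1 g hg.1 hne).1 (hf.2.trans hg.2.symm)
    have hB : (M'.filter fun f => f.2 = Sum.inr 0).card ≤ 1 := by
      rw [Finset.card_le_one]
      intro f hf g hg
      rw [Finset.mem_filter] at hf hg
      by_contra hne
      exact (hM'.2 f hf.1 g hg.1 hne).2 (hf.2.trans hg.2.symm)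
    have hsub : M' ⊆ (M.image fun f => (Sum.inl f.1, Sum.inl f.2)) ∪
        ((M'.filter fun f => f.1 = Sum.inr 0) ∪ (M'.filter fun f => f.2 = Sum.inr 0)) := by
      intro f hf
      have h1 := hM'.1 hf
      simp only [attachLeaf, Finset.mem_union, Finset.mem_image, Finset.mem_insert,
        Finset.mem_singleton] at h1
      simp only [Finset.mem_union, Finset.mem_image, Finset.mem_filter]
      rcases h1 with ⟨g, hg, rfl⟩ | rfl | rfl | rfl
      · exact Or.inl ⟨g, by rw [hMd, Finset.mem_filter]; exact ⟨Finset.mem_univ _, hf⟩, rfl⟩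
      · exact Or.inr (Or.inr ⟨hf, rfl⟩)
      · exact Or.inr (Or.inl ⟨hf, rfl⟩)
      · exact Or.inr (Or.inl ⟨hf, rfl⟩)
    have h1 := Finset.card_le_card hsub
    have h2 := Finset.card_union_le (M.image fun f =>
        ((Sum.inl f.1, Sum.inl f.2) : (V ⊕ Fin 2) × (V ⊕ Fin 2)))
        ((M'.filter fun f => f.1 = Sum.inr 0) ∪ (M'.filter fun f => f.2 = Sum.inr 0))
    have h3 := Finset.card_union_le (M'.filter fun f => f.1 = Sum.inr 0)
      (M'.filter fun f => f.2 = Sum.inr 0)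
    have h4 : (M.image fun f =>
        ((Sum.inl f.1, Sum.inl f.2) : (V ⊕ Fin 2) × (V ⊕ Fin 2))).card ≤ M.card :=
      Finset.card_image_le
    have h5 : (attachLeaf N e).X.card ≤ N.X.card + 1 := by
      refine (Finset.card_union_le _ _).trans ?_
      exact Nat.add_le_add Finset.card_image_le (by simp)
    simp only [Fintype.card_sum, Fintype.card_fin] at hc
    omega

end Aux

/-- `l(N) = p(N) = t(N)`. -/
theorem stmt_15 {V : Type} [Fintype V] [DecidableEq V] (N : Network V)
    (hN : IsPhyloNetwork N) :
    lN N = pN N ∧ pN N = tN N := by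
  obtain ⟨-, hac, hr, hreach, hX, -⟩ := hN
  -- a matching gives a spanning tree with few bad leaves
  have hML : ∀ M, IsMatching N.E M → ∃ (E' : Finset (V × V)) (r : V),
      E' ⊆ N.E ∧ IsArborescence E' r ∧
      (Finset.univ.filter fun v => outDeg E' v = 0 ∧ v ∉ N.X).card + N.X.card + M.card
        ≤ Fintype.card V := by
    intro M hM
    obtain ⟨E', hsub, ha, hME⟩ := matching_to_arb hac hr hreach hM
    refine ⟨E', N.root, hsub, ha, ?_⟩
    rw [← matching_card hM, add_comm M.card]
    apply Nat.add_le_add_right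
    rw [← Finset.card_union_of_disjoint]
    · apply Finset.card_le_card
      intro v hv
      rw [Finset.mem_filter, outDeg_zero_iff]
      refine ⟨Finset.mem_univ _, fun w hw => ?_⟩
      rcases Finset.mem_union.1 hv with h | h
      · exact (outDeg_zero_iff _ _).1 (Finset.mem_filter.1 h).2.1 w (hME hw)
      · rw [hX] at h
        exact (outDeg_zero_iff _ _).1 (Finset.mem_filter.1 h).2 w (hM.1 hw)
    · rw [Finset.disjoint_left]
      intro v h1 h2
      exact (Finset.mem_filter.1 h1).2.2 h2
  have hout : ∀ v, v ∉ N.X → ∃ w, (v, w) ∈ N.E := by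
    intro v hv
    by_contra h
    push Not at h
    apply hv
    rw [hX, Finset.mem_filter]
    exact ⟨Finset.mem_univ _, (outDeg_zero_iff _ _).2 h⟩
  have hemp : IsMatching N.E ∅ := ⟨by simp, by simp⟩
  -- `l ≤ p`
  have hlp : lN N ≤ pN N := by
    have hne : {k | ∃ P : Finset (List V), P.card = k ∧ (∀ p ∈ P, IsDirPath N.E p) ∧
        ∀ v : V, ∃! p, p ∈ P ∧ v ∈ p}.Nonempty := by
      obtain ⟨P, -, hP, hpart⟩ := matching_to_paths hac ∅ hemp
      exact ⟨P.card, P, rfl, fun p hp => ⟨(hP p hp).1,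
        (hP p hp).2.1.imp (fun x y h => hemp.1 h), (hP p hp).2.2⟩, hpart⟩
    obtain ⟨P, hc, hP, hpart⟩ := Nat.sInf_mem hne
    obtain ⟨M, hM, hMc⟩ := paths_to_matching hP hpart
    obtain ⟨E', r, hsub, ha, hle⟩ := hML M hM
    have h1 : lN N ≤ _ := Nat.sInf_le ⟨E', r, hsub, ha, rfl⟩
    have h2 : P.card = dN N := hc
    unfold pN
    omega
  -- `t ≤ l`
  have hlmem : CanMakeTreeBased (lN N) N := by
    have hne : {k | ∃ (E' : Finset (V × V)) (r : V), E' ⊆ N.E ∧ IsArborescence E' r ∧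
        (Finset.univ.filter fun v => outDeg E' v = 0 ∧ v ∉ N.X).card = k}.Nonempty := by
      obtain ⟨E', r, hsub, ha, -⟩ := hML ∅ hemp
      exact ⟨_, E', r, hsub, ha, rfl⟩
    obtain ⟨E', r, hsub, ha, hc⟩ := Nat.sInf_mem hne
    exact arb_to_attach _ N hout E' r hsub ha hc
  have htl : tN N ≤ lN N := Nat.sInf_le hlmem
  -- `p ≤ t`
  have hpt : pN N ≤ tN N := by
    have hne : {k | CanMakeTreeBased k N}.Nonempty := ⟨_, hlmem⟩
    have ht : CanMakeTreeBased (tN N) N := Nat.sInf_mem hne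
    obtain ⟨M, hM, hMc⟩ := attach_to_matching _ N ht
    obtain ⟨P, hPc, hP, hpart⟩ := matching_to_paths hac M hM
    have h1 : dN N ≤ P.card := Nat.sInf_le ⟨P, rfl, fun p hp => ⟨(hP p hp).1,
        (hP p hp).2.1.imp (fun x y h => hM.1 h), (hP p hp).2.2⟩, hpart⟩
    unfold pN
    omega
  omega
end

section
/- Let N be a binary phylogenetic network on X. Then l(N) ≤ p(N): if the vertex set of N can be partitioned into the vertex sets of p(N) + |X| pairwise vertex-disjoint directed paths, then N has a rooted spanning tree with at most p(N) leaves not in X. -/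
open Finset

variable {V : Type} [Fintype V] [DecidableEq V]

/-- `l(N) ≤ p(N)`. -/
theorem stmt_16 {V : Type} [Fintype V] [DecidableEq V] (N : Network V)
    (hN : IsPhyloNetwork N) :
    lN N ≤ pN N := by
  obtain ⟨-, hac, hroot, hreach, hX, -⟩ := hN
  have hne : ({k | ∃ P : Finset (List V), P.card = k ∧ (∀ p ∈ P, IsDirPath N.E p) ∧
      ∀ v : V, ∃! p, p ∈ P ∧ v ∈ p} : Set ℕ).Nonempty := by
    refine ⟨_, Finset.univ.image (fun v : V => [v]), rfl, ?_, ?_⟩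
    · intro p hp
      obtain ⟨v, -, rfl⟩ := Finset.mem_image.1 hp
      exact ⟨by simp, List.isChain_singleton _, by simp⟩
    · intro v
      refine ⟨[v], ⟨by simp, by simp⟩, ?_⟩
      rintro p ⟨hp, hv⟩
      obtain ⟨w, -, rfl⟩ := Finset.mem_image.1 hp
      simp at hv
      rw [hv]
  obtain ⟨P, hPc, hP, hPp⟩ := Nat.sInf_mem hne
  have hroot' : ∀ a, (a, N.root) ∉ N.E := by
    intro a ha
    have h := Finset.card_eq_zero.1 hroot
    have : (a, N.root) ∈ N.E.filter (fun e => e.2 = N.root) := by simp [ha]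
    rw [h] at this
    simp at this
  have hchain : ∀ p ∈ P, ∀ i (h : i + 1 < p.length), (p[i], p[i+1]) ∈ N.E := by
    intro p hp i h
    exact (List.isChain_iff_getElem.1 (hP p hp).2.1) i h
  have hpar : ∀ v, v ≠ N.root → ∃ u, (u, v) ∈ N.E ∧
      ∀ p ∈ P, ∀ i (h : i + 1 < p.length), p[i+1] = v → p[i] = u := by
    intro v hv
    by_cases hc : ∃ p ∈ P, ∃ i, ∃ h : i + 1 < p.length, p[i+1] = v
    · obtain ⟨p, hp, i, h, hi⟩ := hc
      refine ⟨p[i], hi ▸ hchain p hp i h, ?_⟩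
      intro q hq j hj hjv
      have hpq : q = p := (hPp v).unique ⟨hq, hjv ▸ List.getElem_mem _⟩
        ⟨hp, hi ▸ List.getElem_mem _⟩
      subst hpq
      have hij : j + 1 = i + 1 := ((hP q hq).2.2.getElem_inj_iff).1 (hjv.trans hi.symm)
      have : j = i := by omega
      subst this
      rfl
    · push Not at hc
      rcases Relation.ReflTransGen.cases_tail (hreach v) with h | ⟨u, -, hu⟩
      · exact (hv (by rw [h])).elim
      · exact ⟨u, hu, fun p hp i h hi => absurd hi (hc p hp i h)⟩
  choose! par hparE hparP using hpar
  let E' : Finset (V × V) := (Finset.univ.erase N.root).image (fun v => (par v, v))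
  have hE' : ∀ a b, (a, b) ∈ E' ↔ b ≠ N.root ∧ par b = a := by
    intro a b
    simp only [E', Finset.mem_image, Finset.mem_erase, Finset.mem_univ, and_true, Prod.mk.injEq]
    constructor
    · rintro ⟨v, hv, h1, rfl⟩
      exact ⟨hv, h1⟩
    · rintro ⟨h1, h2⟩
      exact ⟨b, h1, h2, rfl⟩
  have harb : IsArborescence E' N.root := by
    refine ⟨?_, ?_, ?_⟩
    · refine Finset.card_eq_zero.2 (Finset.filter_eq_empty_iff.2 ?_)
      rintro ⟨a, b⟩ h rfl
      exact ((hE' _ _).1 h).1 rfl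
    · intro v hv
      refine Finset.card_eq_one.2 ⟨(par v, v), ?_⟩
      ext ⟨a, b⟩
      simp only [Finset.mem_filter, Finset.mem_singleton, hE', Prod.mk.injEq]
      constructor
      · rintro ⟨⟨-, h⟩, rfl⟩
        exact ⟨h.symm, rfl⟩
      · rintro ⟨rfl, rfl⟩
        exact ⟨⟨hv, rfl⟩, rfl⟩
    · have : Std.Irrefl (Relation.TransGen (adjOf N.E)) := ⟨hac⟩
      have hwf : WellFounded (Relation.TransGen (adjOf N.E)) :=
        Finite.wellFounded_of_trans_of_irrefl _
      intro v
      induction v using hwf.induction with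
      | _ v ih =>
        by_cases hv : v = N.root
        · rw [hv]
        · exact (ih (par v) (Relation.TransGen.single (hparE v hv))).tail
            ((hE' _ _).2 ⟨hv, rfl⟩)
  have hsub : E' ⊆ N.E := by
    rintro ⟨a, b⟩ h
    obtain ⟨h1, rfl⟩ := (hE' _ _).1 h
    exact hparE b h1
  have hle : lN N ≤ (Finset.univ.filter fun v => outDeg E' v = 0 ∧ v ∉ N.X).card :=
    Nat.sInf_le ⟨E', N.root, hsub, harb, rfl⟩
  -- every tree leaf is the last vertex of its path
  have hlast : ∀ v, outDeg E' v = 0 → ∀ p ∈ P, v ∈ p → p.getLast? = some v := by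
    intro v hv p hp hvp
    obtain ⟨i, hi, hiv⟩ := List.getElem_of_mem hvp
    by_cases h : i + 1 < p.length
    · exfalso
      have hEd := hchain p hp i h
      have hnr : p[i+1] ≠ N.root := fun hr => hroot' p[i] (by rw [← hr]; exact hEd)
      have hm : (v, p[i+1]) ∈ E' :=
        (hE' _ _).2 ⟨hnr, by rw [← hparP _ hnr p hp i h rfl, hiv]⟩
      have h0 := Finset.card_eq_zero.1 hv
      have : (v, p[i+1]) ∈ E'.filter (fun e => e.1 = v) := by simp [hm]
      rw [h0] at this
      simp at this
    · rw [List.getLast?_eq_getElem?]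
      have : p.length - 1 = i := by omega
      rw [this, List.getElem?_eq_getElem hi, hiv]
  have hX0 : ∀ v ∈ N.X, outDeg E' v = 0 := by
    intro v hv
    rw [hX] at hv
    have hv := (Finset.mem_filter.1 hv).2
    exact Nat.le_zero.1 (hv ▸ Finset.card_le_card (Finset.filter_subset_filter _ hsub))
  choose pth hpth _ using hPp
  have hcard : (N.X ∪ Finset.univ.filter fun v => outDeg E' v = 0 ∧ v ∉ N.X).card ≤ P.card := by
    have h0 : ∀ v ∈ (N.X ∪ Finset.univ.filter fun v => outDeg E' v = 0 ∧ v ∉ N.X),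
        outDeg E' v = 0 := by
      intro v hv
      rcases Finset.mem_union.1 hv with h | h
      · exact hX0 v h
      · exact (Finset.mem_filter.1 h).2.1
    refine Finset.card_le_card_of_injOn pth (fun v _ => (hpth v).1) ?_
    intro v hv w hw hvw
    have h1 := hlast v (h0 v hv) _ (hpth v).1 (hpth v).2
    have h2 := hlast w (h0 w hw) _ (hpth w).1 (hpth w).2
    have hvw' : pth v = pth w := hvw
    rw [hvw', h2] at h1
    exact (Option.some.inj h1).symm
  rw [Finset.card_union_of_disjoint] at hcard
  · have hd : P.card = dN N := hPc
    unfold pN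
    omega
  · rw [Finset.disjoint_left]
    intro v hv h
    exact (Finset.mem_filter.1 h).2.2 hv
end

section
/- Let N be a binary phylogenetic network on X. Then p(N) ≤ t(N). -/
open Finset

variable {V : Type} [Fintype V] [DecidableEq V]

section Aux

theorem aux_unique_parent {U : Type} [Fintype U] [DecidableEq U] {E : Finset (U × U)} {v a b : U}
    (h : inDeg E v = 1) (ha : (a, v) ∈ E) (hb : (b, v) ∈ E) : a = b := by
  unfold inDeg at h
  have := Finset.card_le_one.1 h.le (a, v) (by simp [ha]) (b, v) (by simp [hb])
  exact congrArg Prod.fst this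

theorem aux_no_parent {U : Type} [Fintype U] [DecidableEq U] {E : Finset (U × U)} {v a : U}
    (h : inDeg E v = 0) (ha : (a, v) ∈ E) : False := by
  unfold inDeg at h
  have := Finset.card_eq_zero.1 h
  have h2 : (a, v) ∈ E.filter (fun e => e.2 = v) := by simp [ha]
  rw [this] at h2
  simp at h2

theorem aux_child {U : Type} [Fintype U] [DecidableEq U] {E : Finset (U × U)} {v : U} :
    outDeg E v ≠ 0 ↔ ∃ w, (v, w) ∈ E := by
  unfold outDeg
  rw [← Nat.pos_iff_ne_zero, Finset.card_pos]
  constructor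
  · rintro ⟨⟨a, b⟩, h⟩
    simp at h
    exact ⟨b, h.2 ▸ h.1⟩
  · rintro ⟨w, h⟩
    exact ⟨(v, w), by simp [h]⟩

theorem aux_arb_unique {U : Type} [Fintype U] [DecidableEq U] {E : Finset (U × U)} {r : U}
    (h : IsArborescence E r) {v a b : U} (ha : (a, v) ∈ E) (hb : (b, v) ∈ E) : a = b := by
  by_cases hv : v = r
  · subst hv; exact (aux_no_parent h.1 ha).elim
  · exact aux_unique_parent (h.2.1 v hv) ha hb

theorem aux_arb_acyclic {U : Type} [Fintype U] [DecidableEq U] {E : Finset (U × U)} {r : U}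
    (h : IsArborescence E r) (v : U) : ¬ Relation.TransGen (adjOf E) v v := by
  have := h.2.2 v
  induction this with
  | refl =>
    intro hc
    obtain ⟨z, _, hz⟩ := Relation.TransGen.tail'_iff.1 hc
    exact aux_no_parent h.1 hz
  | tail hab hbc ih =>
    intro hc
    obtain ⟨z, hz1, hz⟩ := Relation.TransGen.tail'_iff.1 hc
    have : z = _ := aux_arb_unique h hz hbc
    subst this
    exact ih (Relation.TransGen.head' hbc hz1)

theorem aux_chain_reach {U : Type} {R : U → U → Prop} :
    ∀ (p : List U) (a b : U), p.IsChain R → p.head? = some a → p.getLast? = some b →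
      Relation.ReflTransGen R a b
  | [], a, b, _, h, _ => by simp at h
  | [x], a, b, _, h, h2 => by
    simp at h h2; subst h; subst h2; exact .refl
  | x :: y :: l, a, b, hc, h, h2 => by
    rw [List.isChain_cons_cons] at hc
    simp at h; subst h
    refine .head hc.1 (aux_chain_reach (y :: l) y b hc.2 rfl ?_)
    simpa [List.getLast?_cons_cons] using h2

/-- In a chain, a non-head member has a predecessor which is not the last vertex. -/
theorem aux_pred {U : Type} {R : U → U → Prop} :
    ∀ (p : List U) (w : U), p.IsChain R → p.Nodup → w ∈ p → p.head? ≠ some w →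
      ∃ u ∈ p, R u w ∧ p.getLast? ≠ some u
  | [], w, _, _, h, _ => by simp at h
  | [x], w, _, _, h, h2 => by simp at h h2; exact (h2 h.symm).elim
  | x :: y :: l, w, hc, hn, h, h2 => by
    rw [List.isChain_cons_cons] at hc
    by_cases hy : w = y
    · subst hy
      refine ⟨x, by simp, hc.1, ?_⟩
      intro hl
      rw [List.getLast?_cons_cons] at hl
      have := List.mem_of_getLast? hl
      exact (List.nodup_cons.1 hn).1 this
    · have hx : w ≠ x := by rintro rfl; simp at h2
      have hm : w ∈ y :: l := by
        rcases List.mem_cons.1 h with h | h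
        · exact (hx h).elim
        · exact h
      obtain ⟨u, hu, hr, hl⟩ := aux_pred (y :: l) w hc.2 (List.nodup_cons.1 hn).2 hm
        (by simpa using Ne.symm hy)
      exact ⟨u, List.mem_cons_of_mem _ hu, hr, by rwa [List.getLast?_cons_cons]⟩

def AuxPart {U : Type} (R : U → U → Prop) (P : Finset (List U)) : Prop :=
  (∀ p ∈ P, p ≠ [] ∧ p.IsChain R ∧ p.Nodup) ∧ ∀ v : U, ∃! p, p ∈ P ∧ v ∈ p

theorem aux_part_exists {U : Type} [Fintype U] [DecidableEq U] (R : U → U → Prop) :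
    ∃ P, AuxPart R P := by
  refine ⟨Finset.univ.image (fun v => [v]), ?_, ?_⟩
  · intro p hp
    simp at hp
    obtain ⟨a, rfl⟩ := hp
    simp
  · intro v
    refine ⟨[v], by simp, ?_⟩
    rintro p ⟨hp, hv⟩
    simp at hp
    obtain ⟨a, rfl⟩ := hp
    simp at hv
    rw [hv]

theorem aux_tree_part {U : Type} [Fintype U] [DecidableEq U] (R : U → U → Prop)
    (huniq : ∀ a b v, R a v → R b v → a = b) (hac : ∀ v, ¬ Relation.TransGen R v v)
    (X : Finset U) (hX : ∀ v, v ∉ X → ∃ w, R v w) :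
    ∃ P, AuxPart R P ∧ P.card ≤ X.card := by
  obtain ⟨P, hP, hmin⟩ := WellFounded.has_min (measure (Finset.card (α := List U))).wf
    {P | AuxPart R P} (aux_part_exists R)
  have hP' : AuxPart R P := hP
  refine ⟨P, hP', ?_⟩
  obtain ⟨h1, h2⟩ := hP'
  have hend : ∀ p ∈ P, ∀ v, p.getLast? = some v → v ∈ X := by
    intro p hp v hv
    by_contra hvX
    obtain ⟨w, hw⟩ := hX v hvX
    obtain ⟨q, ⟨hq, hwq⟩, hqu⟩ := h2 w
    have hvp : v ∈ p := List.mem_of_getLast? hv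
    by_cases hh : q.head? = some w
    · have hpq : p ≠ q := by
        rintro rfl
        have := aux_chain_reach p w v (h1 p hp).2.1 hh hv
        exact hac w (Relation.TransGen.tail' this hw)
      have hdisj : ∀ a, a ∈ p → a ∉ q := fun a ha hb =>
        hpq ((h2 a).unique ⟨hp, ha⟩ ⟨hq, hb⟩)
      have hqe : q ∈ P.erase p := Finset.mem_erase.2 ⟨hpq.symm, hq⟩
      refine hmin (insert (p ++ q) ((P.erase p).erase q)) ⟨?_, ?_⟩ ?_
      · intro s hs
        rcases Finset.mem_insert.1 hs with rfl | hs
        · refine ⟨by simp [(h1 p hp).1], ?_, ?_⟩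
          · rw [List.isChain_append]
            refine ⟨(h1 p hp).2.1, (h1 q hq).2.1, ?_⟩
            intro x hx y hy
            rw [hv] at hx; rw [hh] at hy
            simp at hx hy
            subst hx; subst hy; exact hw
          · rw [List.nodup_append]
            refine ⟨(h1 p hp).2.2, (h1 q hq).2.2, ?_⟩
            rintro a ha b hb rfl
            exact hdisj a ha hb
        · exact h1 s (Finset.mem_of_mem_erase (Finset.mem_of_mem_erase hs))
      · intro a
        obtain ⟨s, ⟨hs, has⟩, hsu⟩ := h2 a
        by_cases hapq : a ∈ p ++ q
        · refine ⟨p ++ q, ⟨Finset.mem_insert_self _ _, hapq⟩, ?_⟩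
          rintro t ⟨ht, hat⟩
          rcases Finset.mem_insert.1 ht with rfl | ht
          · rfl
          · simp only [Finset.mem_erase] at ht
            rcases List.mem_append.1 hapq with h | h
            · exact (ht.2.1 ((h2 a).unique ⟨ht.2.2, hat⟩ ⟨hp, h⟩)).elim
            · exact (ht.1 ((h2 a).unique ⟨ht.2.2, hat⟩ ⟨hq, h⟩)).elim
        · have hap : a ∉ p := fun h => hapq (List.mem_append_left _ h)
          have haq : a ∉ q := fun h => hapq (List.mem_append_right _ h)
          refine ⟨s, ⟨?_, has⟩, ?_⟩
          · refine Finset.mem_insert_of_mem (Finset.mem_erase.2 ⟨?_, Finset.mem_erase.2 ⟨?_, hs⟩⟩)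
            · rintro rfl; exact haq has
            · rintro rfl; exact hap has
          · rintro t ⟨ht, hat⟩
            rcases Finset.mem_insert.1 ht with rfl | ht
            · exact (hapq hat).elim
            · exact hsu t ⟨Finset.mem_of_mem_erase (Finset.mem_of_mem_erase ht), hat⟩
      · change Finset.card _ < Finset.card _
        have := Finset.card_insert_le (p ++ q) ((P.erase p).erase q)
        have e1 := Finset.card_erase_add_one hqe
        have e2 := Finset.card_erase_add_one hp
        omega
    · obtain ⟨u, huq, hur, hul⟩ := aux_pred q w (h1 q hq).2.1 (h1 q hq).2.2 hwq hh
      have : u = v := huniq _ _ _ hur hw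
      subst this
      have : q = p := (h2 u).unique ⟨hq, huq⟩ ⟨hp, hvp⟩
      subst this
      exact hul hv
  by_cases hemp : Nonempty U
  · refine Finset.card_le_card_of_injOn (fun p => p.getLast?.getD hemp.some) ?_ ?_
    · intro p hp
      obtain ⟨v, hv⟩ : ∃ v, p.getLast? = some v :=
        ⟨p.getLast (h1 p hp).1, List.getLast?_eq_some_getLast _⟩
      simpa [hv] using hend p hp v hv
    · intro p hp q hq hpq
      obtain ⟨v, hv⟩ : ∃ v, p.getLast? = some v :=
        ⟨p.getLast (h1 p hp).1, List.getLast?_eq_some_getLast _⟩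
      obtain ⟨w, hw⟩ : ∃ v, q.getLast? = some v :=
        ⟨q.getLast (h1 q hq).1, List.getLast?_eq_some_getLast _⟩
      simp [hv, hw] at hpq
      subst hpq
      exact (h2 v).unique ⟨hp, List.mem_of_getLast? hv⟩ ⟨hq, List.mem_of_getLast? hw⟩
  · have : P = ∅ := by
      rw [Finset.eq_empty_iff_forall_notMem]
      intro p hp
      obtain ⟨v, -⟩ := List.exists_mem_of_ne_nil _ (h1 p hp).1
      exact hemp ⟨v⟩
    simp [this]

theorem aux_part_mono {U : Type} {R S : U → U → Prop} (h : ∀ a b, R a b → S a b)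
    {P : Finset (List U)} (hP : AuxPart R P) : AuxPart S P :=
  ⟨fun p hp => ⟨(hP.1 p hp).1, (hP.1 p hp).2.1.imp (fun {a b} => h a b), (hP.1 p hp).2.2⟩, hP.2⟩

/-! Edges of the network with an attached leaf. -/

section edges
variable {U : Type} [Fintype U] [DecidableEq U] (N : Network U) (e : U × U)

theorem aux_edge_ll (a b : U) : (Sum.inl a, Sum.inl b) ∈ (attachLeaf N e).E ↔
    (a, b) ∈ N.E ∧ (a, b) ≠ e := by
  simp [attachLeaf, and_comm]

theorem aux_edge_l0 (a : U) : (Sum.inl a, Sum.inr 0) ∈ (attachLeaf N e).E ↔ a = e.1 := by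
  simp [attachLeaf]

theorem aux_edge_l1 (a : U) : (Sum.inl a, Sum.inr 1) ∉ (attachLeaf N e).E := by
  simp [attachLeaf]

theorem aux_edge_0l (a : U) : (Sum.inr 0, Sum.inl a) ∈ (attachLeaf N e).E ↔ a = e.2 := by
  simp [attachLeaf]

theorem aux_edge_1 (a : U ⊕ Fin 2) : (Sum.inr 1, a) ∉ (attachLeaf N e).E := by
  simp [attachLeaf]

theorem aux_edge_00 : (Sum.inr 0, Sum.inr 0) ∉ (attachLeaf N e).E := by
  simp [attachLeaf]

theorem aux_edge_01 : (Sum.inr 0, Sum.inr 1) ∈ (attachLeaf N e).E := by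
  simp [attachLeaf]

end edges

theorem aux_chain_filter {U : Type} [Fintype U] [DecidableEq U] (N : Network U) (e : U × U)
    (he : e ∈ N.E) : ∀ p : List (U ⊕ Fin 2), p.IsChain (adjOf (attachLeaf N e).E) →
      (p.filterMap Sum.getLeft?).IsChain (adjOf N.E)
  | [], _ => by simp
  | [Sum.inl a], _ => by simp
  | [Sum.inr i], _ => by simp [List.filterMap_cons]
  | Sum.inr i :: y :: l, h => by
    have := aux_chain_filter N e he (y :: l) (List.isChain_cons_cons.1 h).2
    simpa [List.filterMap_cons] using this
  | Sum.inl a :: Sum.inl b :: l, h => by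
    rw [List.isChain_cons_cons] at h
    have := aux_chain_filter N e he (Sum.inl b :: l) h.2
    have h1 := ((aux_edge_ll N e a b).1 h.1).1
    simp at this ⊢
    exact ⟨h1, this⟩
  | [Sum.inl a, Sum.inr i], _ => by simp [List.filterMap_cons]
  | Sum.inl a :: Sum.inr i :: y :: l, h => by
    rw [List.isChain_cons_cons, List.isChain_cons_cons] at h
    obtain ⟨h1, h2, h3⟩ := h
    have ih := aux_chain_filter N e he (y :: l) h3
    unfold adjOf at h1 h2
    fin_cases i
    · have ha := (aux_edge_l0 N e a).1 h1
      rcases y with b | j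
      · have hb := (aux_edge_0l N e b).1 h2
        simp [List.filterMap_cons] at ih ⊢
        refine ⟨?_, ih⟩
        unfold adjOf
        rw [ha, hb]; exact he
      · fin_cases j
        · exact (aux_edge_00 N e h2).elim
        · rcases l with _ | ⟨z, l⟩
          · simp [List.filterMap_cons]
          · rw [List.isChain_cons_cons] at h3
            exact (aux_edge_1 N e z h3.1).elim
    · exact (aux_edge_l1 N e a h1).elim

theorem aux_part_attach {U : Type} [Fintype U] [DecidableEq U] (N : Network U) (e : U × U)
    (he : e ∈ N.E) {P : Finset (List (U ⊕ Fin 2))}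
    (hP : AuxPart (adjOf (attachLeaf N e).E) P) :
    ∃ Q, AuxPart (adjOf N.E) Q ∧ Q.card ≤ P.card := by
  have hmem : ∀ (v : U) (p : List (U ⊕ Fin 2)),
      v ∈ p.filterMap Sum.getLeft? ↔ Sum.inl v ∈ p := by
    intro v p
    simp [List.mem_filterMap]
  refine ⟨(P.image (List.filterMap Sum.getLeft?)).erase [], ⟨?_, ?_⟩,
    (Finset.card_erase_le).trans Finset.card_image_le⟩
  · intro q hq
    rw [Finset.mem_erase, Finset.mem_image] at hq
    obtain ⟨hq0, p, hp, rfl⟩ := hq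
    refine ⟨hq0, aux_chain_filter N e he p (hP.1 p hp).2.1, ?_⟩
    refine (hP.1 p hp).2.2.filterMap ?_
    intro a b c ha hb
    simp at ha hb
    rw [ha, hb]
  · intro v
    obtain ⟨p, ⟨hp, hv⟩, hu⟩ := hP.2 (Sum.inl v)
    refine ⟨p.filterMap Sum.getLeft?, ⟨?_, (hmem v p).2 hv⟩, ?_⟩
    · refine Finset.mem_erase.2 ⟨List.ne_nil_of_mem ((hmem v p).2 hv),
        Finset.mem_image_of_mem _ hp⟩
    · rintro q ⟨hq, hvq⟩
      rw [Finset.mem_erase, Finset.mem_image] at hq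
      obtain ⟨hq0, p', hp', rfl⟩ := hq
      rw [hu p' ⟨hp', (hmem v p').1 hvq⟩]

theorem aux_attach_X {U : Type} [Fintype U] [DecidableEq U] (N : Network U) (e : U × U) :
    (attachLeaf N e).X.card = N.X.card + 1 := by
  unfold attachLeaf
  rw [Finset.card_union_of_disjoint (by simp), Finset.card_image_of_injective _ Sum.inl_injective]
  simp

theorem aux_main (k : ℕ) : ∀ {U : Type} [Fintype U] [DecidableEq U] (N : Network U),
    CanMakeTreeBased k N → ∃ P, AuxPart (adjOf N.E) P ∧ P.card ≤ N.X.card + k := by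
  induction k with
  | zero =>
    intro U _ _ N h
    obtain ⟨E', r, hE, hA, hX⟩ : TreeBased N := h
    obtain ⟨P, hP, hc⟩ := aux_tree_part (adjOf E') (fun a b v => aux_arb_unique hA)
      (aux_arb_acyclic hA) N.X (fun v hv => aux_child.1 (fun h => hv (hX v h)))
    exact ⟨P, aux_part_mono (fun a b h => hE h) hP, hc⟩
  | succ k ih =>
    intro U _ _ N h
    obtain ⟨e, he, h⟩ : ∃ e ∈ N.E, CanMakeTreeBased k (attachLeaf N e) := h
    obtain ⟨P, hP, hc⟩ := ih _ h
    obtain ⟨Q, hQ, hc2⟩ := aux_part_attach N e he hP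
    rw [aux_attach_X] at hc
    exact ⟨Q, hQ, by omega⟩

/-- Degree criterion helper. -/
theorem aux_inDeg_one {U : Type} [Fintype U] [DecidableEq U] {E : Finset (U × U)} {v a : U}
    (ha : (a, v) ∈ E) (hu : ∀ b, (b, v) ∈ E → b = a) : inDeg E v = 1 := by
  unfold inDeg
  rw [Finset.card_eq_one]
  refine ⟨(a, v), ?_⟩
  ext ⟨x, y⟩
  simp only [Finset.mem_filter, Finset.mem_singleton, Prod.mk.injEq]
  constructor
  · rintro ⟨h, rfl⟩; exact ⟨hu x h, rfl⟩
  · rintro ⟨rfl, rfl⟩; exact ⟨ha, rfl⟩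

theorem aux_inDeg_zero {U : Type} [Fintype U] [DecidableEq U] {E : Finset (U × U)} {v : U}
    (hu : ∀ b, (b, v) ∉ E) : inDeg E v = 0 := by
  unfold inDeg
  rw [Finset.card_eq_zero, Finset.filter_eq_empty_iff]
  rintro ⟨x, y⟩ h rfl
  exact hu x h

theorem aux_inDeg_exists {U : Type} [Fintype U] [DecidableEq U] {E : Finset (U × U)} {v : U}
    (h : inDeg E v = 1) : ∃ a, (a, v) ∈ E := by
  by_contra hc
  push Not at hc
  rw [aux_inDeg_zero hc] at h
  omega

theorem aux_make (k : ℕ) : ∀ {U : Type} [Fintype U] [DecidableEq U] (N : Network U)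
    (E' : Finset (U × U)) (r : U), E' ⊆ N.E → IsArborescence E' r →
    (∀ v, v ∉ N.X → outDeg N.E v ≠ 0) →
    (Finset.univ.filter fun v => outDeg E' v = 0 ∧ v ∉ N.X).card = k →
    ∃ m, CanMakeTreeBased m N := by
  induction k with
  | zero =>
    intro U _ _ N E' r hE hA hX hc
    refine ⟨0, E', r, hE, hA, ?_⟩
    intro v hv
    by_contra hvX
    rw [Finset.card_eq_zero, Finset.filter_eq_empty_iff] at hc
    exact hc (Finset.mem_univ v) ⟨hv, hvX⟩
  | succ k ih =>
    intro U _ _ N E' r hE hA hX hc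
    have hpos : 0 < (Finset.univ.filter fun v => outDeg E' v = 0 ∧ v ∉ N.X).card := by omega
    obtain ⟨v, hv⟩ := Finset.card_pos.1 hpos
    have hvB := hv
    simp only [Finset.mem_filter, Finset.mem_univ, true_and] at hv
    obtain ⟨hv0, hvX⟩ := hv
    obtain ⟨w, hw⟩ := aux_child.1 (hX v hvX)
    have hnov : ∀ z, (v, z) ∉ E' := fun z hz => aux_child.2 ⟨z, hz⟩ hv0
    let F : Finset ((U ⊕ Fin 2) × (U ⊕ Fin 2)) :=
      E'.image (fun f => (Sum.inl f.1, Sum.inl f.2)) ∪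
        {(Sum.inl v, Sum.inr 0), (Sum.inr 0, Sum.inr 1)}
    have hFll : ∀ a b : U, ((Sum.inl a, Sum.inl b) : (U ⊕ Fin 2) × (U ⊕ Fin 2)) ∈ F ↔
        (a, b) ∈ E' := by intro a b; simp [F]
    have hFx0 : ∀ a : U ⊕ Fin 2, ((a, Sum.inr 0) : (U ⊕ Fin 2) × (U ⊕ Fin 2)) ∈ F ↔
        a = Sum.inl v := by intro a; simp [F]
    have hFx1 : ∀ a : U ⊕ Fin 2, ((a, Sum.inr 1) : (U ⊕ Fin 2) × (U ⊕ Fin 2)) ∈ F ↔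
        a = Sum.inr 0 := by intro a; simp [F]
    have hFrl : ∀ (i : Fin 2) (b : U), ((Sum.inr i, Sum.inl b) : (U ⊕ Fin 2) × (U ⊕ Fin 2)) ∉ F := by
      intro i b; simp [F]
    have hreach : ∀ u : U, Relation.ReflTransGen (adjOf F) (Sum.inl r) (Sum.inl u) := by
      intro u
      induction hA.2.2 u with
      | refl => exact .refl
      | tail _ h ih => exact ih.tail ((hFll _ _).2 h)
    have hr0 : Relation.ReflTransGen (adjOf F) (Sum.inl r) (Sum.inr 0) :=
      (hreach v).tail ((hFx0 _).2 rfl)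
    have hr1 : Relation.ReflTransGen (adjOf F) (Sum.inl r) (Sum.inr 1) :=
      hr0.tail ((hFx1 _).2 rfl)
    suffices hs : ∃ m, CanMakeTreeBased m (attachLeaf N (v, w)) by
      obtain ⟨m, hm⟩ := hs
      exact ⟨m + 1, (v, w), hw, hm⟩
    refine ih (attachLeaf N (v, w)) F (Sum.inl r) ?_ ⟨?_, ?_, ?_⟩ ?_ ?_
    · rintro ⟨a, b⟩ hab
      rcases b with b | j
      · rcases a with a | i
        · rw [hFll] at hab
          rw [aux_edge_ll]
          refine ⟨hE hab, ?_⟩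
          rintro h
          rw [Prod.mk.injEq] at h
          obtain ⟨rfl, rfl⟩ := h
          exact hnov _ hab
        · exact (hFrl _ _ hab).elim
      · fin_cases j
        · have := (hFx0 a).1 hab
          subst this
          exact (aux_edge_l0 N (v, w) v).2 rfl
        · have := (hFx1 a).1 hab
          subst this
          exact aux_edge_01 N (v, w)
    · apply aux_inDeg_zero
      rintro (b | i) hb
      · exact aux_no_parent hA.1 ((hFll _ _).1 hb)
      · exact hFrl _ _ hb
    · rintro (u | j) hu
      · have hur : u ≠ r := by rintro rfl; exact hu rfl
        obtain ⟨a, ha⟩ := aux_inDeg_exists (hA.2.1 u hur)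
        refine aux_inDeg_one ((hFll a u).2 ha) ?_
        rintro (b | i) hb
        · rw [aux_arb_unique hA ((hFll _ _).1 hb) ha]
        · exact (hFrl _ _ hb).elim
      · fin_cases j
        · exact aux_inDeg_one ((hFx0 _).2 rfl) (fun b hb => (hFx0 b).1 hb)
        · exact aux_inDeg_one ((hFx1 _).2 rfl) (fun b hb => (hFx1 b).1 hb)
    · rintro (u | j)
      · exact hreach u
      · fin_cases j
        · exact hr0
        · exact hr1
    · rintro (u | j) hu
      · have huX : u ∉ N.X := by
          intro h; apply hu; simp [attachLeaf, h]
        obtain ⟨z, hz⟩ := aux_child.1 (hX u huX)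
        rw [aux_child]
        by_cases h : (u, z) = (v, w)
        · exact ⟨Sum.inr 0, (aux_edge_l0 _ _ _).2 (congrArg Prod.fst h)⟩
        · exact ⟨Sum.inl z, (aux_edge_ll _ _ _ _).2 ⟨hz, h⟩⟩
      · fin_cases j
        · exact aux_child.2 ⟨_, aux_edge_01 _ _⟩
        · exact (hu (by simp [attachLeaf])).elim
    · have hset : (Finset.univ.filter fun u => outDeg F u = 0 ∧ u ∉ (attachLeaf N (v, w)).X) =
          ((Finset.univ.filter fun u => outDeg E' u = 0 ∧ u ∉ N.X).erase v).image Sum.inl := by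
        ext u
        simp only [Finset.mem_filter, Finset.mem_univ, true_and, Finset.mem_image,
          Finset.mem_erase]
        constructor
        · rintro ⟨hu0, huX⟩
          rcases u with u | j
          · refine ⟨u, ⟨?_, ?_, ?_⟩, rfl⟩
            · rintro rfl
              exact aux_child.2 ⟨_, (hFx0 _).2 rfl⟩ hu0
            · by_contra h
              obtain ⟨z, hz⟩ := aux_child.1 h
              exact aux_child.2 ⟨_, (hFll _ _).2 hz⟩ hu0
            · intro h; apply huX; simp [attachLeaf, h]
          · fin_cases j
            · exact (aux_child.2 ⟨_, (hFx1 _).2 rfl⟩ hu0).elim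
            · exact (huX (by simp [attachLeaf])).elim
        · rintro ⟨a, ⟨hav, ha0, haX⟩, rfl⟩
          refine ⟨?_, ?_⟩
          · by_contra h
            obtain ⟨z, hz⟩ := aux_child.1 h
            rcases z with z | j
            · exact aux_child.2 ⟨z, (hFll _ _).1 hz⟩ ha0
            · fin_cases j
              · exact hav (Sum.inl_injective ((hFx0 _).1 hz))
              · have := (hFx1 _).1 hz
                simp at this
          · simp [attachLeaf, haX]
      rw [hset, Finset.card_image_of_injective _ Sum.inl_injective, Finset.card_erase_of_mem hvB, hc]
      rfl

theorem aux_arb_exists {U : Type} [Fintype U] [DecidableEq U] (N : Network U)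
    (hN : IsPhyloNetwork N) : ∃ E', E' ⊆ N.E ∧ IsArborescence E' N.root := by
  obtain ⟨-, hac, hr, hreach, -, -⟩ := hN
  have hpar : ∀ v, v ≠ N.root → ∃ a, (a, v) ∈ N.E := by
    intro v hv
    rcases Relation.ReflTransGen.cases_tail (hreach v) with h | ⟨c, _, hc⟩
    · exact (hv h).elim
    · exact ⟨c, hc⟩
  have hpar' : ∀ v, ∃ a, v ≠ N.root → (a, v) ∈ N.E := by
    intro v
    by_cases h : v = N.root
    · exact ⟨v, fun h' => (h' h).elim⟩
    · obtain ⟨a, ha⟩ := hpar v h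
      exact ⟨a, fun _ => ha⟩
  choose f hf using hpar'
  have hmem : ∀ a v, (a, v) ∈ (Finset.univ.filter (fun v => v ≠ N.root)).image (fun v => (f v, v)) ↔
      v ≠ N.root ∧ f v = a := by
    intro a v
    simp only [Finset.mem_image, Finset.mem_filter, Finset.mem_univ, true_and, Prod.mk.injEq]
    constructor
    · rintro ⟨x, hx, h1, rfl⟩; exact ⟨hx, h1⟩
    · rintro ⟨h1, h2⟩; exact ⟨v, h1, h2, rfl⟩
  refine ⟨(Finset.univ.filter (fun v => v ≠ N.root)).image (fun v => (f v, v)), ?_, ?_, ?_, ?_⟩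
  · rintro ⟨a, v⟩ h
    rw [hmem] at h
    rw [← h.2]; exact hf v h.1
  · apply aux_inDeg_zero
    intro b hb
    exact ((hmem _ _).1 hb).1 rfl
  · intro v hv
    exact aux_inDeg_one ((hmem (f v) v).2 ⟨hv, rfl⟩) (fun b hb => ((hmem _ _).1 hb).2.symm)
  · have : IsTrans U (Relation.TransGen (adjOf N.E)) := ⟨fun _ _ _ => Relation.TransGen.trans⟩
    have : Std.Irrefl (Relation.TransGen (adjOf N.E)) := ⟨hac⟩
    have wf : WellFounded (Relation.TransGen (adjOf N.E)) :=
      Finite.wellFounded_of_trans_of_irrefl _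
    intro v
    induction v using wf.induction with
    | _ v ih =>
      by_cases hv : v = N.root
      · rw [hv]
      · exact (ih (f v) (.single (hf v hv))).tail ((hmem _ _).2 ⟨hv, rfl⟩)

end Aux

/-- `p(N) ≤ t(N)`. -/
theorem stmt_17 {V : Type} [Fintype V] [DecidableEq V] (N : Network V)
    (hN : IsPhyloNetwork N) :
    pN N ≤ tN N := by
  obtain ⟨E', hE, hA⟩ := aux_arb_exists N hN
  obtain ⟨m, hm⟩ := aux_make _ N E' N.root hE hA (by
    intro v hv h
    apply hv
    rw [hN.2.2.2.2.1]
    simp [h]) rfl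
  have ht : CanMakeTreeBased (tN N) N := Nat.sInf_mem (s := {k | CanMakeTreeBased k N}) ⟨m, hm⟩
  obtain ⟨P, hP, hc⟩ := aux_main _ N ht
  have hd : dN N ≤ P.card := Nat.sInf_le ⟨P, rfl, fun p hp => hP.1 p hp, hP.2⟩
  unfold pN
  omega
end

section
/- Let N be a binary phylogenetic network on X. Then t(N) ≤ l(N): if N has a rooted spanning tree T with exactly l(N) leaves not in X, then attaching, for each such leaf ℓ of T, a new leaf to an edge of N directed out of ℓ yields a tree-based network; hence N can be made tree-based by attaching at most l(N) new leaves. -/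
open Finset

variable {V : Type} [Fintype V] [DecidableEq V]

lemma aux_inDeg_zero_s18 {V : Type} [DecidableEq V] (E : Finset (V × V)) (v : V) :
    inDeg E v = 0 ↔ ∀ u, (u, v) ∉ E := by
  simp only [inDeg, Finset.card_eq_zero, Finset.filter_eq_empty_iff]
  constructor
  · intro h u hu
    exact h hu rfl
  · rintro h ⟨a, b⟩ hab rfl
    exact h a hab

lemma aux_outDeg_zero {V : Type} [DecidableEq V] (E : Finset (V × V)) (v : V) :
    outDeg E v = 0 ↔ ∀ u, (v, u) ∉ E := by
  simp only [outDeg, Finset.card_eq_zero, Finset.filter_eq_empty_iff]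
  constructor
  · intro h u hu
    exact h hu rfl
  · rintro h ⟨a, b⟩ hab rfl
    exact h b hab

lemma aux_inDeg_one_s18 {V : Type} [DecidableEq V] (E : Finset (V × V)) (v : V) :
    inDeg E v = 1 ↔ ∃ u, (u, v) ∈ E ∧ ∀ w, (w, v) ∈ E → w = u := by
  simp only [inDeg, Finset.card_eq_one]
  constructor
  · rintro ⟨⟨a, b⟩, h⟩
    have h1 : (a, b) ∈ E.filter fun e => e.2 = v := by rw [h]; simp
    obtain ⟨h4, h2⟩ := Finset.mem_filter.1 h1
    simp only at h2
    subst h2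
    refine ⟨a, h4, fun w hw => ?_⟩
    have h3 : (w, b) ∈ E.filter fun e => e.2 = b := Finset.mem_filter.2 ⟨hw, rfl⟩
    rw [h] at h3
    simpa using h3
  · rintro ⟨u, hu, h⟩
    refine ⟨(u, v), ?_⟩
    ext ⟨a, b⟩
    simp only [Finset.mem_filter, Finset.mem_singleton, Prod.mk.injEq]
    constructor
    · rintro ⟨h1, rfl⟩
      exact ⟨h a h1, rfl⟩
    · rintro ⟨rfl, rfl⟩
      exact ⟨hu, rfl⟩

/-- Every phylogenetic network has a rooted spanning tree. -/
lemma aux_exists_tree {V : Type} [Fintype V] [DecidableEq V] (N : Network V)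
    (hN : IsPhyloNetwork N) :
    ∃ E' : Finset (V × V), E' ⊆ N.E ∧ IsArborescence E' N.root := by
  classical
  obtain ⟨-, hac, hr0, hreach, -, -⟩ := hN
  have hpar : ∀ v : V, ∃ u, v ≠ N.root → (u, v) ∈ N.E := by
    intro v
    rcases Relation.ReflTransGen.cases_tail (hreach v) with h | ⟨u, -, h⟩
    · exact ⟨v, fun h' => absurd h h'⟩
    · exact ⟨u, fun _ => h⟩
  choose p hp using hpar
  have hmem : ∀ a b, (a, b) ∈ ((Finset.univ.filter fun v => v ≠ N.root).image
      fun v => (p v, v)) ↔ b ≠ N.root ∧ a = p b := by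
    intro a b
    simp only [Finset.mem_image, Finset.mem_filter, Finset.mem_univ, true_and, Prod.mk.injEq]
    constructor
    · rintro ⟨v, h1, h2, rfl⟩
      exact ⟨h1, h2.symm⟩
    · rintro ⟨h1, h2⟩
      exact ⟨b, h1, h2.symm, rfl⟩
  refine ⟨(Finset.univ.filter fun v => v ≠ N.root).image fun v => (p v, v), ?_, ?_, ?_, ?_⟩
  · rintro ⟨a, b⟩ h
    obtain ⟨h1, rfl⟩ := (hmem a b).1 h
    exact hp b h1
  · rw [aux_inDeg_zero_s18]
    intro u hu
    exact ((hmem _ _).1 hu).1 rfl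
  · intro v hv
    rw [aux_inDeg_one_s18]
    exact ⟨p v, (hmem _ _).2 ⟨hv, rfl⟩, fun w hw => ((hmem _ _).1 hw).2⟩
  · have hirr : Std.Irrefl (Relation.TransGen (adjOf N.E)) := ⟨hac⟩
    have hwf : WellFounded (Relation.TransGen (adjOf N.E)) :=
      Finite.wellFounded_of_trans_of_irrefl _
    intro v
    induction v using hwf.induction with
    | _ v ih =>
      by_cases hv : v = N.root
      · rw [hv]
      · exact (ih (p v) (Relation.TransGen.single (hp v hv))).tail ((hmem _ _).2 ⟨hv, rfl⟩)

/-- Attaching one leaf per bad leaf of the spanning tree gives a tree-based network. -/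
lemma aux_main_s18 (k : ℕ) : ∀ {V : Type} [Fintype V] [DecidableEq V] (N : Network V)
    (E' : Finset (V × V)) (r : V), E' ⊆ N.E → IsArborescence E' r →
    (∀ v, v ∉ N.X → ∃ w, (v, w) ∈ N.E) →
    (Finset.univ.filter fun v => outDeg E' v = 0 ∧ v ∉ N.X).card = k →
    CanMakeTreeBased k N := by
  induction k with
  | zero =>
    intro V _ _ N E' r hsub harb _ hcard
    refine ⟨E', r, hsub, harb, fun v hv => ?_⟩
    rw [Finset.card_eq_zero, Finset.filter_eq_empty_iff] at hcard
    by_contra hx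
    exact hcard (Finset.mem_univ v) ⟨hv, hx⟩
  | succ k ih =>
    intro V _ _ N E' r hsub harb hout hcard
    have hne : (Finset.univ.filter fun v => outDeg E' v = 0 ∧ v ∉ N.X).Nonempty := by
      rw [← Finset.card_pos]; omega
    obtain ⟨v, hv⟩ := hne
    have hv' := hv
    simp only [Finset.mem_filter, Finset.mem_univ, true_and] at hv'
    obtain ⟨hv0, hvX⟩ := hv'
    rw [aux_outDeg_zero] at hv0
    obtain ⟨w, hw⟩ := hout v hvX
    obtain ⟨h0, h1, hreach⟩ := harb
    rw [aux_inDeg_zero_s18] at h0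
    set T : Finset ((V ⊕ Fin 2) × (V ⊕ Fin 2)) :=
      (E'.image fun f => (Sum.inl f.1, Sum.inl f.2)) ∪
        {(Sum.inl v, Sum.inr 0), (Sum.inr 0, Sum.inr 1)} with hT
    have hll : ∀ a b : V, ((Sum.inl a, Sum.inl b) : (V ⊕ Fin 2) × (V ⊕ Fin 2)) ∈ T ↔
        (a, b) ∈ E' := by
      intro a b; simp [hT]
    have hlr : ∀ (a : V) (i : Fin 2),
        ((Sum.inl a, Sum.inr i) : (V ⊕ Fin 2) × (V ⊕ Fin 2)) ∈ T ↔ a = v ∧ i = 0 := by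
      intro a b; simp [hT]
    have hrl : ∀ (i : Fin 2) (a : V),
        ((Sum.inr i, Sum.inl a) : (V ⊕ Fin 2) × (V ⊕ Fin 2)) ∉ T := by
      intro a b; simp [hT]
    have hrr : ∀ (i j : Fin 2),
        ((Sum.inr i, Sum.inr j) : (V ⊕ Fin 2) × (V ⊕ Fin 2)) ∈ T ↔ i = 0 ∧ j = 1 := by
      intro a b; simp [hT]
    refine ⟨(v, w), hw, ih (attachLeaf N (v, w)) T (Sum.inl r) ?_ ⟨?_, ?_, ?_⟩ ?_ ?_⟩
    · rintro ⟨a | i, b | j⟩ h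
      · have h' := (hll a b).1 h
        have hav : a ≠ v := by
          rintro rfl
          exact hv0 b h'
        simp [attachLeaf, hsub h', hav]
      · obtain ⟨rfl, rfl⟩ := (hlr a j).1 h
        simp [attachLeaf]
      · exact absurd h (hrl i b)
      · obtain ⟨rfl, rfl⟩ := (hrr i j).1 h
        simp [attachLeaf]
    · rw [aux_inDeg_zero_s18]
      rintro (u | i) h
      · exact h0 u ((hll _ _).1 h)
      · exact hrl _ _ h
    · rintro (u | i) hu
      · have hur : u ≠ r := fun h => hu (by rw [h])
        obtain ⟨p, hp, hp'⟩ := (aux_inDeg_one_s18 _ _).1 (h1 u hur)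
        rw [aux_inDeg_one_s18]
        refine ⟨Sum.inl p, (hll _ _).2 hp, ?_⟩
        rintro (q | i) hq
        · rw [hp' q ((hll _ _).1 hq)]
        · exact absurd hq (hrl _ _)
      · rw [aux_inDeg_one_s18]
        fin_cases i
        · refine ⟨Sum.inl v, (hlr _ _).2 ⟨rfl, rfl⟩, ?_⟩
          rintro (q | i) hq
          · rw [((hlr _ _).1 hq).1]
          · have := ((hrr _ _).1 hq).2
            simp at this
        · refine ⟨Sum.inr 0, (hrr _ _).2 ⟨rfl, rfl⟩, ?_⟩
          rintro (q | i) hq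
          · have := ((hlr _ _).1 hq).2
            simp at this
          · rw [((hrr _ _).1 hq).1]
    · have hl : ∀ u : V, Relation.ReflTransGen (adjOf T) (Sum.inl r) (Sum.inl u) := by
        intro u
        induction hreach u with
        | refl => exact Relation.ReflTransGen.refl
        | tail _ hbc ihb => exact ihb.tail ((hll _ _).2 hbc)
      have hr0 : Relation.ReflTransGen (adjOf T) (Sum.inl r) (Sum.inr 0) :=
        (hl v).tail ((hlr _ _).2 ⟨rfl, rfl⟩)
      rintro (u | i)
      · exact hl u
      · fin_cases i
        · exact hr0
        · exact hr0.tail ((hrr _ _).2 ⟨rfl, rfl⟩)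
    · rintro (u | i) hu
      · have huX : u ∉ N.X := by
          intro h; exact hu (by simp [attachLeaf, h])
        obtain ⟨x, hx⟩ := hout u huX
        by_cases hxe : (u, x) = (v, w)
        · refine ⟨Sum.inr 0, ?_⟩
          simp only [Prod.mk.injEq] at hxe
          simp [attachLeaf, hxe.1]
        · refine ⟨Sum.inl x, ?_⟩
          simp only [Prod.mk.injEq] at hxe
          simp only [attachLeaf, Finset.mem_union, Finset.mem_image, Finset.mem_erase]
          exact Or.inl ⟨(u, x), ⟨by simpa using hxe, hx⟩, rfl⟩
      · fin_cases i
        · exact ⟨Sum.inr 1, by simp [attachLeaf]⟩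
        · exact absurd (by simp [attachLeaf]) hu
    · have heq : (Finset.univ.filter fun u => outDeg T u = 0 ∧ u ∉ (attachLeaf N (v, w)).X) =
          ((Finset.univ.filter fun u => outDeg E' u = 0 ∧ u ∉ N.X).erase v).map
            Function.Embedding.inl := by
        ext u
        simp only [Finset.mem_filter, Finset.mem_univ, true_and, Finset.mem_map,
          Finset.mem_erase, aux_outDeg_zero]
        constructor
        · rintro ⟨ho, hX⟩
          rcases u with u | i
          · refine ⟨u, ⟨?_, fun x hx => ho (Sum.inl x) ((hll _ _).2 hx), ?_⟩, rfl⟩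
            · rintro rfl
              exact ho (Sum.inr 0) ((hlr _ _).2 ⟨rfl, rfl⟩)
            · intro h; exact hX (by simp [attachLeaf, h])
          · fin_cases i
            · exact absurd ((hrr _ _).2 ⟨rfl, rfl⟩) (ho (Sum.inr 1))
            · exact absurd (by simp [attachLeaf]) hX
        · rintro ⟨u, ⟨huv, ho, hX⟩, rfl⟩
          refine ⟨?_, ?_⟩
          · rintro (x | i) hx
            · exact ho x ((hll _ _).1 hx)
            · exact huv ((hlr _ _).1 hx).1
          · simpa [attachLeaf] using hX
      rw [heq, Finset.card_map, Finset.card_erase_of_mem hv, hcard]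
      rfl

/-- `t(N) ≤ l(N)`. -/
theorem stmt_18 {V : Type} [Fintype V] [DecidableEq V] (N : Network V)
    (hN : IsPhyloNetwork N) :
    tN N ≤ lN N := by
  classical
  obtain ⟨E₀, hE₀, hA₀⟩ := aux_exists_tree N hN
  have hmem : lN N ∈ {k | ∃ (E' : Finset (V × V)) (r : V), E' ⊆ N.E ∧ IsArborescence E' r ∧
      (Finset.univ.filter fun v => outDeg E' v = 0 ∧ v ∉ N.X).card = k} :=
    Nat.sInf_mem ⟨_, E₀, N.root, hE₀, hA₀, rfl⟩
  obtain ⟨E', r, hsub, harb, hcard⟩ := hmem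
  refine Nat.sInf_le (aux_main_s18 _ N E' r hsub harb ?_ hcard)
  intro v hv
  rw [hN.2.2.2.2.1] at hv
  simp only [Finset.mem_filter, Finset.mem_univ, true_and, aux_outDeg_zero, not_forall,
    not_not] at hv
  exact hv
end
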